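/- arXiv:1811.02075 — 3 statements merged into one kernel-verified Lean document; each statement's English description precedes it below -/
import Mathlib

section
/- Every normal periodic tiling of the plane is balanced: for a normal tiling invariant under translations in two linearly independent directions, the limits v(𝔗) = lim_{r→∞} v(r,M)/t(r,M) and e(𝔗) = lim_{r→∞} e(r,M)/t(r,M) exist (for every center point M). -/
open Filter Metric

noncomputable section

/-- The Euclidean plane ℝ². -/
abbrev Plane : Type := EuclideanSpace ℝ (Fin 2)

/-- A tiling of the plane: a countable family of closed sets (tiles) whose union is
all of ℝ² and whose interiors are pairwise disjoint. -/
structure PlaneTiling where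
  tiles : Set (Set Plane)
  countable : tiles.Countable
  closed : ∀ t ∈ tiles, IsClosed t
  covers : ⋃₀ tiles = Set.univ
  interiors_disjoint : ∀ t₁ ∈ tiles, ∀ t₂ ∈ tiles, t₁ ≠ t₂ → interior t₁ ∩ interior t₂ = ∅

/-- A tiling is monohedral by a prototile `P` if every tile is an isometric copy of `P`. -/
def IsMonohedralBy (T : PlaneTiling) (P : Set Plane) : Prop :=
  ∀ t ∈ T.tiles, ∃ f : Plane ≃ᵢ Plane, t = f '' P

/-- A tiling is periodic if it is invariant under translations in two linearly
independent directions. -/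
def IsPeriodic (T : PlaneTiling) : Prop :=
  ∃ v w : Plane, LinearIndependent ℝ ![v, w] ∧
    (∀ t ∈ T.tiles, (fun x => x + v) '' t ∈ T.tiles) ∧
    (∀ t ∈ T.tiles, (fun x => x + w) '' t ∈ T.tiles)

/-- A tiling is normal if every tile is a closed topological disk, the intersection of
any two tiles is connected (possibly empty), and the tiles are uniformly bounded. -/
def IsNormal (T : PlaneTiling) : Prop :=
  (∀ t ∈ T.tiles, Nonempty (t ≃ₜ (closedBall (0 : Plane) 1))) ∧
  (∀ t₁ ∈ T.tiles, ∀ t₂ ∈ T.tiles, IsPreconnected (t₁ ∩ t₂)) ∧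
  (∃ u U : ℝ, 0 < u ∧ u ≤ U ∧
    ∀ t ∈ T.tiles, (∃ c, closedBall c u ⊆ t) ∧ (∃ c, t ⊆ closedBall c U))

/-- The valence of a point: the number of tiles containing it. -/
def valence (T : PlaneTiling) (x : Plane) : ℕ := {t | t ∈ T.tiles ∧ x ∈ t}.ncard

/-- A vertex of the tiling: a point belonging to at least three tiles. -/
def IsTilingVertex (T : PlaneTiling) (x : Plane) : Prop := 3 ≤ valence T x

/-- An edge of the tiling: the closure of a connected component of the set of points
lying in exactly two tiles. -/
def IsTilingEdge (T : PlaneTiling) (e : Set Plane) : Prop :=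
  ∃ x : Plane, valence T x = 2 ∧
    e = closure (connectedComponentIn {y : Plane | valence T y = 2} x)

/-- Two tiles are adjacent if they share an edge of the tiling. -/
def Adjacent (T : PlaneTiling) (t₁ t₂ : Set Plane) : Prop :=
  t₁ ∈ T.tiles ∧ t₂ ∈ T.tiles ∧ t₁ ≠ t₂ ∧ ∃ e, IsTilingEdge T e ∧ e ⊆ t₁ ∧ e ⊆ t₂

/-- The number of adjacents of a tile. -/
def numAdjacents (T : PlaneTiling) (t : Set Plane) : ℕ := {t' | Adjacent T t t'}.ncard

/-- Tiles meeting the boundary circle of the disk `D(r,M)` but not contained in it. -/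
def boundaryTiles (T : PlaneTiling) (r : ℝ) (M : Plane) : Set (Set Plane) :=
  {t | t ∈ T.tiles ∧ (t ∩ sphere M r).Nonempty ∧ ¬ t ⊆ closedBall M r}

/-- Tiles surrounded by the tiles of `boundaryTiles T r M` but not among them:
they lie in a bounded connected component of the complement of the union of the
boundary tiles. -/
def enclosedTiles (T : PlaneTiling) (r : ℝ) (M : Plane) : Set (Set Plane) :=
  {t | t ∈ T.tiles ∧ t ∉ boundaryTiles T r M ∧
    ∃ x ∈ t, t ⊆ connectedComponentIn (⋃₀ boundaryTiles T r M)ᶜ x ∧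
      Bornology.IsBounded (connectedComponentIn (⋃₀ boundaryTiles T r M)ᶜ x)}

/-- The patch `A(r,M)` of tiles generated by the disk `D(r,M)`. -/
def patch (T : PlaneTiling) (r : ℝ) (M : Plane) : Set (Set Plane) :=
  {t | t ∈ T.tiles ∧ t ⊆ closedBall M r} ∪ boundaryTiles T r M ∪ enclosedTiles T r M

/-- `t(r,M)`: the number of tiles in the patch `A(r,M)`. -/
def tCount (T : PlaneTiling) (r : ℝ) (M : Plane) : ℕ := (patch T r M).ncard

/-- `v(r,M)`: the number of vertices of the tiling in the patch `A(r,M)`. -/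
def vCount (T : PlaneTiling) (r : ℝ) (M : Plane) : ℕ :=
  {x | IsTilingVertex T x ∧ x ∈ ⋃₀ patch T r M}.ncard

/-- `e(r,M)`: the number of edges of the tiling in the patch `A(r,M)`. -/
def eCount (T : PlaneTiling) (r : ℝ) (M : Plane) : ℕ :=
  {e | IsTilingEdge T e ∧ e ⊆ ⋃₀ patch T r M}.ncard

/-- `v_j(r,M)`: the number of vertices of valence `j` in the patch `A(r,M)`. -/
def vjCount (T : PlaneTiling) (j : ℕ) (r : ℝ) (M : Plane) : ℕ :=
  {x | valence T x = j ∧ x ∈ ⋃₀ patch T r M}.ncard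

/-- `t_h(r,M)`: the number of tiles with exactly `h` adjacents in the patch `A(r,M)`. -/
def thCount (T : PlaneTiling) (h : ℕ) (r : ℝ) (M : Plane) : ℕ :=
  {t | t ∈ patch T r M ∧ numAdjacents T t = h}.ncard

/-- A normal tiling is balanced if the limits `v(𝔗)` and `e(𝔗)` exist. -/
def IsBalanced (T : PlaneTiling) : Prop :=
  IsNormal T ∧ ∀ M : Plane,
    (∃ L : ℝ, Tendsto (fun r : ℝ => (vCount T r M : ℝ) / (tCount T r M : ℝ)) atTop (nhds L)) ∧
    (∃ L : ℝ, Tendsto (fun r : ℝ => (eCount T r M : ℝ) / (tCount T r M : ℝ)) atTop (nhds L))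

/-- A normal tiling is strongly balanced if the limits `t_h(𝔗)` and `v_j(𝔗)` exist
for all `h, j ≥ 3`. -/
def IsStronglyBalanced (T : PlaneTiling) : Prop :=
  IsNormal T ∧ ∀ M : Plane, ∀ n : ℕ, 3 ≤ n →
    (∃ L : ℝ, Tendsto (fun r : ℝ => (thCount T n r M : ℝ) / (tCount T r M : ℝ)) atTop (nhds L)) ∧
    (∃ L : ℝ, Tendsto (fun r : ℝ => (vjCount T n r M : ℝ) / (tCount T r M : ℝ)) atTop (nhds L))

/-- The cross product (signed area) of two vectors in the plane. -/
def cross2 (u v : Plane) : ℝ := u 0 * v 1 - u 1 * v 0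

/-- Five points in strictly convex position, listed in cyclic order around the
boundary of their convex hull: every point is extreme (convex independence), and the
turns at consecutive vertices all have the same orientation. -/
def IsConvexPentagon (p : Fin 5 → Plane) : Prop :=
  ConvexIndependent ℝ p ∧
  ∃ ε : ℝ, (ε = 1 ∨ ε = -1) ∧
    ∀ i : Fin 5, 0 < ε * cross2 (p (i + 1) - p i) (p (i + 2) - p (i + 1))

/-- The internal angle of the pentagon with vertices `p` at the vertex `p i`. -/
def pentagonAngle (p : Fin 5 → Plane) (i : Fin 5) : ℝ :=
  EuclideanGeometry.angle (p (i - 1)) (p i) (p (i + 1))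

open scoped Pointwise Topology

/-- The number of points of a lattice in the disk of radius `r` about the origin. -/
def latticeCount (L : Submodule ℤ Plane) (r : ℝ) : ℕ :=
  {x : Plane | x ∈ L ∧ ‖x‖ ≤ r}.ncard

theorem finite_lattice_norm_le (L : Submodule ℤ Plane) [DiscreteTopology L] (r : ℝ) :
    {x : Plane | x ∈ L ∧ ‖x‖ ≤ r}.Finite := by
  have h : DiscreteTopology L.toAddSubgroup := ‹DiscreteTopology L›
  have hc : IsClosed (L : Set Plane) := AddSubgroup.isClosed_of_discrete (H := L.toAddSubgroup)
  have hf := Metric.finite_isBounded_inter_isClosed (K := closedBall (0 : Plane) r)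
    (s := (L : Set Plane)) DiscreteTopology.isDiscrete isBounded_closedBall hc
  refine hf.subset ?_
  rintro x ⟨hx, hr⟩
  exact ⟨by simpa using hr, hx⟩

theorem exists_tendsto_latticeCount_div_sq (L : Submodule ℤ Plane) [DiscreteTopology L]
    [IsZLattice ℝ L] :
    ∃ c : ℝ, 0 < c ∧ Tendsto (fun r : ℝ => (latticeCount L r : ℝ) / r ^ 2) atTop (𝓝 c) := by
  have hball : {x ∈ (Set.univ : Set Plane) | ‖x‖ ^ 2 ≤ 1} = closedBall 0 1 := by
    ext x
    simp
  have h := ZLattice.covolume.tendsto_card_le_div' L (X := Set.univ)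
    (F := fun x : Plane => ‖x‖ ^ 2) (fun _ _ _ _ => Set.mem_univ _)
    (fun x r hr => by simp [norm_smul, mul_pow])
    (by rw [hball]; exact isBounded_closedBall)
    (by rw [hball]; exact measurableSet_closedBall)
    (by rw [hball]; exact (convex_closedBall _ _).addHaar_frontier _)
  refine ⟨_, ?_, (h.comp (tendsto_pow_atTop (α := ℝ) two_ne_zero)).congr' ?_⟩
  · rw [hball]
    refine div_pos ?_ (ZLattice.covolume_pos L _)
    exact ENNReal.toReal_pos (Metric.measure_closedBall_pos _ _ one_pos).ne'
      MeasureTheory.measure_closedBall_lt_top.ne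
  · filter_upwards [eventually_ge_atTop 0] with r hr
    simp only [Function.comp, latticeCount, Nat.card_coe_set_eq]
    congr 3
    ext x
    simp [sq_le_sq₀ (norm_nonneg x) hr, and_comm]

theorem tendsto_comp_add_div_sq {f : ℝ → ℝ} {c : ℝ}
    (h : Tendsto (fun r => f r / r ^ 2) atTop (𝓝 c)) (d : ℝ) :
    Tendsto (fun r => f (r + d) / r ^ 2) atTop (𝓝 c) := by
  have h1 : Tendsto (fun r : ℝ => 1 + d * r⁻¹) atTop (𝓝 (1 + d * 0)) :=
    (tendsto_inv_atTop_zero.const_mul d).const_add 1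
  have h2 := (h.comp (tendsto_atTop_add_const_right atTop d tendsto_id)).mul (h1.pow 2)
  simp only [mul_zero, add_zero, one_pow, mul_one] at h2
  refine h2.congr' ?_
  filter_upwards [eventually_gt_atTop 0, eventually_gt_atTop (-d)] with r hr hd
  have : r + d ≠ 0 := by linarith
  simp only [Function.comp, id]
  field_simp

theorem eq_zero_of_vadd_set_eq {s : Set Plane} (hne : s.Nonempty) {c : Plane} {D : ℝ}
    (hs : s ⊆ closedBall c D) {x : Plane} (hx : x +ᵥ s = s) : x = 0 := by
  obtain ⟨p, hp⟩ := hne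
  have hmem : ∀ n : ℕ, (n : ℝ) • x + p ∈ s := by
    intro n
    induction n with
    | zero => simpa using hp
    | succ n ih =>
      rw [← hx]
      refine ⟨_, ih, ?_⟩
      simp only [vadd_eq_add]
      push_cast
      module
  by_contra h0
  have hpos : 0 < ‖x‖ := norm_pos_iff.mpr h0
  obtain ⟨n, hn⟩ := exists_nat_gt ((D + dist p c) / ‖x‖)
  rw [div_lt_iff₀ hpos] at hn
  have h1 := hs (hmem n)
  rw [mem_closedBall] at h1
  have h2 : dist ((n : ℝ) • x + p) p = n * ‖x‖ := by
    simp [dist_eq_norm, norm_smul]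
  have h3 := dist_triangle_right ((n : ℝ) • x + p) p c
  linarith

/-- A lattice-invariant family of nonempty sets of bounded size has a system of orbit
representatives which all lie in one disk. -/
theorem exists_orbit_representatives (b : Module.Basis (Fin 2) ℝ Plane) {X : Set (Set Plane)}
    {D : ℝ} (hne : ∀ s ∈ X, s.Nonempty) (hD : ∀ s ∈ X, ∃ c, s ⊆ closedBall c D)
    (hinv : ∀ x ∈ Submodule.span ℤ (Set.range b), ∀ s ∈ X, x +ᵥ s ∈ X) (M : Plane) :
    ∃ (R : Set (Set Plane)) (K : ℝ), R ⊆ X ∧ (∀ s ∈ R, s ⊆ closedBall M K) ∧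
      (∀ s ∈ X, ∃ t ∈ R, ∃ x ∈ Submodule.span ℤ (Set.range b), s = x +ᵥ t) ∧
      (∀ s ∈ R, ∀ t ∈ R, ∀ x ∈ Submodule.span ℤ (Set.range b),
        ∀ y ∈ Submodule.span ℤ (Set.range b), x +ᵥ s = y +ᵥ t → s = t ∧ x = y) := by
  set L := Submodule.span ℤ (Set.range b)
  let S : Setoid X :=
    { r := fun s t => ∃ x ∈ L, (t : Set Plane) = x +ᵥ (s : Set Plane)
      iseqv :=
        { refl := fun s => ⟨0, L.zero_mem, by simp⟩
          symm := by
            rintro s t ⟨x, hx, h⟩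
            exact ⟨-x, L.neg_mem hx, by rw [h, neg_vadd_vadd]⟩
          trans := by
            rintro s t u ⟨x, hx, h⟩ ⟨y, hy, h'⟩
            exact ⟨y + x, L.add_mem hy hx, by rw [h', h, add_vadd]⟩ } }
  have hrep : ∀ q : Quotient S, ∃ s : X, ⟦s⟧ = q ∧
      (s : Set Plane) ⊆ closedBall M (∑ i, ‖b i‖ + 2 * D) := by
    intro q
    obtain ⟨s, rfl⟩ := Quotient.exists_rep q
    obtain ⟨p, hp⟩ := hne s s.2
    obtain ⟨c, hc⟩ := hD s s.2
    set z : Plane := -(ZSpan.floor b (p - M) : Plane)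
    have hz : z ∈ L := L.neg_mem (ZSpan.floor b (p - M)).2
    refine ⟨⟨z +ᵥ (s : Set Plane), hinv z hz s s.2⟩, Quotient.sound ?_, ?_⟩
    · exact ⟨-z, L.neg_mem hz, by simp⟩
    · rintro _ ⟨y, hy, rfl⟩
      have h1 : ‖z + p - M‖ ≤ ∑ i, ‖b i‖ := by
        have h : z + p - M = ZSpan.fract b (p - M) := by
          rw [ZSpan.fract_apply, sub_eq_add_neg (p - M), add_comm (p - M), add_sub_assoc]
        rw [h]
        exact ZSpan.norm_fract_le b (p - M)
      have h2 := mem_closedBall.mp (hc hy)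
      have h3 := mem_closedBall.mp (hc hp)
      have h4 := dist_triangle_right y p c
      rw [← dist_eq_norm] at h1
      have h5 := dist_triangle (z + y) (z + p) M
      rw [dist_add_left] at h5
      simp only [mem_closedBall, vadd_eq_add]
      linarith
  choose f hf hfK using hrep
  refine ⟨Set.range fun q => (f q : Set Plane), ∑ i, ‖b i‖ + 2 * D, ?_, ?_, ?_, ?_⟩
  · rintro _ ⟨q, rfl⟩
    exact (f q).2
  · rintro _ ⟨q, rfl⟩
    exact hfK q
  · intro s hs
    obtain ⟨x, hx, h⟩ := Quotient.exact (hf ⟦⟨s, hs⟩⟧)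
    exact ⟨_, ⟨_, rfl⟩, x, hx, h⟩
  · rintro _ ⟨q, rfl⟩ _ ⟨q', rfl⟩ x hx y hy h
    have h1 : (f q' : Set Plane) = (-y + x) +ᵥ (f q : Set Plane) := by
      rw [add_vadd, h, neg_vadd_vadd]
    have hq : q = q' := by
      rw [← hf q, ← hf q']
      exact Quotient.sound ⟨-y + x, L.add_mem (L.neg_mem hy) hx, h1⟩
    subst hq
    have h2 := eq_zero_of_vadd_set_eq (hne _ (f q).2) (hfK q) h1.symm
    exact ⟨rfl, (neg_add_eq_zero.mp h2).symm⟩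

/-- The number of members of a lattice-invariant family of sets in a disk of radius `r`, up to
a bounded change of the radius, is asymptotic to a multiple of `r ^ 2`. -/
theorem exists_tendsto_ncard_div_sq (b : Module.Basis (Fin 2) ℝ Plane) {X : Set (Set Plane)}
    {D : ℝ} (hne : ∀ s ∈ X, s.Nonempty) (hD : ∀ s ∈ X, ∃ c, s ⊆ closedBall c D)
    (hinv : ∀ x ∈ Submodule.span ℤ (Set.range b), ∀ s ∈ X, x +ᵥ s ∈ X)
    {M : Plane} {a : ℝ} {C : ℝ → Set (Set Plane)}
    (hlow : ∀ r, {s | s ∈ X ∧ s ⊆ closedBall M (r - a)} ⊆ C r)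
    (hup : ∀ r, 0 ≤ r → C r ⊆ {s | s ∈ X ∧ s ⊆ closedBall M (r + a)}) :
    ∃ c : ℝ, Tendsto (fun r : ℝ => ((C r).ncard : ℝ) / r ^ 2) atTop (𝓝 c) ∧
      (X.Nonempty → (∀ r, {s | s ∈ X ∧ s ⊆ closedBall M r}.Finite) → 0 < c) := by
  obtain ⟨R, K, hRX, hRK, hcov, hinj⟩ := exists_orbit_representatives b hne hD hinv M
  set L := Submodule.span ℤ (Set.range b)
  by_cases hR : R.Finite
  · obtain ⟨c, hc, hlim⟩ := exists_tendsto_latticeCount_div_sq L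
    let P : ℝ → Set (Set Plane × Plane) := fun ρ => R ×ˢ {x : Plane | x ∈ L ∧ ‖x‖ ≤ ρ}
    let g : Set Plane × Plane → Set Plane := fun p => p.2 +ᵥ p.1
    have hPfin : ∀ ρ, (P ρ).Finite := fun ρ => hR.prod (finite_lattice_norm_le L ρ)
    have hPcard : ∀ ρ, (P ρ).ncard = R.ncard * latticeCount L ρ := fun ρ => Set.ncard_prod
    have hg : ∀ ρ, Set.InjOn g (P ρ) := by
      rintro ρ ⟨s, x⟩ ⟨hs, hx, -⟩ ⟨t, y⟩ ⟨ht, hy, -⟩ h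
      obtain ⟨h1, h2⟩ := hinj s hs t ht x hx y hy h
      exact Prod.ext h1 h2
    have hsub1 : ∀ r, g '' P (r + (-a - K)) ⊆ C r := by
      rintro r _ ⟨⟨s, x⟩, ⟨hs, hx, hxr⟩, rfl⟩
      refine hlow r ⟨hinv x hx s (hRX hs), ?_⟩
      rintro _ ⟨y, hy, rfl⟩
      have h1 := mem_closedBall.mp (hRK s hs hy)
      have h2 := dist_triangle (x + y) y M
      have h3 : dist (x + y) y = ‖x‖ := by simp [dist_eq_norm]
      simp only [mem_closedBall, vadd_eq_add]
      dsimp only at hxr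
      linarith
    have hsub2 : ∀ r, 0 ≤ r → C r ⊆ g '' P (r + (a + K)) := by
      intro r hr s hs
      obtain ⟨hsX, hsr⟩ := hup r hr hs
      obtain ⟨t, ht, x, hx, rfl⟩ := hcov s hsX
      refine ⟨(t, x), ⟨ht, hx, ?_⟩, rfl⟩
      obtain ⟨y, hy⟩ := hne t (hRX ht)
      have h1 := mem_closedBall.mp (hRK t ht hy)
      have h2 := mem_closedBall.mp (hsr (Set.vadd_mem_vadd_set hy))
      have h3 : dist (x + y) y = ‖x‖ := by simp [dist_eq_norm]
      have h4 := dist_triangle_right (x + y) y M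
      rw [vadd_eq_add] at h2
      dsimp only
      linarith
    have hle1 : ∀ r, 0 ≤ r → R.ncard * latticeCount L (r + (-a - K)) ≤ (C r).ncard := by
      intro r hr
      rw [← hPcard, ← (hg _).ncard_image]
      exact Set.ncard_le_ncard (hsub1 r) (((hPfin _).image g).subset (hsub2 r hr))
    have hle2 : ∀ r, 0 ≤ r → (C r).ncard ≤ R.ncard * latticeCount L (r + (a + K)) := by
      intro r hr
      rw [← hPcard, ← (hg _).ncard_image]
      exact Set.ncard_le_ncard (hsub2 r hr) ((hPfin _).image g)
    refine ⟨R.ncard * c, ?_, ?_⟩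
    · refine tendsto_of_tendsto_of_tendsto_of_le_of_le'
        ((tendsto_comp_add_div_sq hlim (-a - K)).const_mul (R.ncard : ℝ))
        ((tendsto_comp_add_div_sq hlim (a + K)).const_mul (R.ncard : ℝ)) ?_ ?_
      · filter_upwards [eventually_ge_atTop 0] with r hr
        simp only [← mul_div_assoc]
        gcongr
        exact_mod_cast hle1 r hr
      · filter_upwards [eventually_ge_atTop 0] with r hr
        simp only [← mul_div_assoc]
        gcongr
        exact_mod_cast hle2 r hr
    · rintro ⟨s, hs⟩ -
      obtain ⟨t, ht, -⟩ := hcov s hs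
      have : 0 < R.ncard := (Set.ncard_pos hR).mpr ⟨t, ht⟩
      positivity
  · refine ⟨0, tendsto_const_nhds.congr' ?_, fun _ hfin => ?_⟩
    · filter_upwards [eventually_ge_atTop (K + a)] with r hr
      have : (C r).Infinite := by
        refine Set.Infinite.mono ?_ hR
        intro s hs
        refine hlow r ⟨hRX hs, (hRK s hs).trans (closedBall_subset_closedBall ?_)⟩
        linarith
      simp [this.ncard]
    · exact absurd ((hfin K).subset fun s hs => ⟨hRX hs, hRK s hs⟩) hR

namespace PlaneTiling

variable {T : PlaneTiling}

/-- The periods of a tiling: the vectors such that translation by them in either direction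
maps tiles to tiles. -/
def periods (T : PlaneTiling) : AddSubgroup Plane where
  carrier := {x | ∀ t ∈ T.tiles, x +ᵥ t ∈ T.tiles ∧ -x +ᵥ t ∈ T.tiles}
  zero_mem' := fun t ht => by simpa using ht
  add_mem' := by
    intro x y hx hy t ht
    refine ⟨?_, ?_⟩
    · rw [add_vadd]
      exact (hx _ (hy t ht).1).1
    · rw [neg_add, add_vadd]
      exact (hx _ (hy t ht).2).2
  neg_mem' := by
    intro x hx t ht
    rw [neg_neg]
    exact (hx t ht).symm

/-- Translating every tile into a tile hits every tile, because the translated tiles still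
cover the plane. -/
theorem mem_periods_of_image_mem (hint : ∀ t ∈ T.tiles, (interior t).Nonempty) {v : Plane}
    (hv : ∀ t ∈ T.tiles, (fun x => x + v) '' t ∈ T.tiles) : v ∈ T.periods := by
  have hv' : ∀ t ∈ T.tiles, v +ᵥ t ∈ T.tiles := fun t ht => by
    have h := hv t ht
    simp only [add_comm _ v] at h
    exact h
  intro t ht
  refine ⟨hv' t ht, ?_⟩
  have hdense : Dense (⋂ s ∈ T.tiles, (frontier s)ᶜ) := by
    refine dense_biInter_of_isOpen (fun s _ => isClosed_frontier.isOpen_compl) T.countable ?_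
    intro s hs
    exact interior_eq_empty_iff_dense_compl.mp (interior_frontier (T.closed s hs))
  obtain ⟨y, hyt, hy⟩ := hdense.inter_open_nonempty _ isOpen_interior (hint t ht)
  obtain ⟨s, hs, hys⟩ : -v + y ∈ ⋃₀ T.tiles := by rw [T.covers]; trivial
  have hmem : y ∈ v +ᵥ s := ⟨_, hys, by simp⟩
  have hy' : y ∈ interior (v +ᵥ s) := by
    by_contra h
    refine Set.mem_iInter₂.mp hy (v +ᵥ s) (hv' s hs) ?_
    exact ⟨subset_closure hmem, h⟩
  have heq : v +ᵥ s = t := by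
    by_contra h
    have h0 := T.interiors_disjoint _ (hv' s hs) t ht h
    exact Set.notMem_empty y (h0 ▸ ⟨hy', hyt⟩)
  rw [← heq, neg_vadd_vadd]
  exact hs

theorem valence_add {x : Plane} (hx : x ∈ T.periods) (y : Plane) :
    valence T (x + y) = valence T y := by
  unfold valence
  rw [← Set.ncard_image_of_injective {t | t ∈ T.tiles ∧ y ∈ t} (AddAction.injective x)]
  congr 1
  ext t
  constructor
  · rintro ⟨ht, hyt⟩
    refine ⟨-x +ᵥ t, ⟨(hx t ht).2, ?_⟩, by simp⟩
    exact ⟨_, hyt, by simp⟩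
  · rintro ⟨s, ⟨hs, hys⟩, rfl⟩
    exact ⟨(hx s hs).1, ⟨y, hys, rfl⟩⟩

theorem isTilingEdge_vadd {x : Plane} (hx : x ∈ T.periods) {e : Set Plane}
    (he : IsTilingEdge T e) : IsTilingEdge T (x +ᵥ e) := by
  obtain ⟨y, hy, rfl⟩ := he
  refine ⟨x + y, by rw [valence_add hx, hy], ?_⟩
  have himg : Homeomorph.addLeft x '' {z : Plane | valence T z = 2} =
      {z : Plane | valence T z = 2} := by
    ext z
    constructor
    · rintro ⟨w, hw, rfl⟩
      exact (valence_add hx w).trans hw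
    · intro hz
      refine ⟨-x + z, ?_, by simp⟩
      exact (valence_add (T.periods.neg_mem hx) z).trans hz
  have h := (Homeomorph.addLeft x).image_connectedComponentIn
    (s := {z : Plane | valence T z = 2}) hy
  rw [himg] at h
  have h' := (Homeomorph.addLeft x).image_closure
    (connectedComponentIn {z : Plane | valence T z = 2} y)
  rw [h] at h'
  exact h'

section Bounded

variable {u U : ℝ}

theorem subset_closedBall_of_mem (hU : ∀ t ∈ T.tiles, ∃ c, t ⊆ closedBall c U)
    {t : Set Plane} (ht : t ∈ T.tiles) {x M : Plane} (hx : x ∈ t) {ρ : ℝ} (hρ : dist x M ≤ ρ) :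
    t ⊆ closedBall M (ρ + 2 * U) := by
  obtain ⟨c, hc⟩ := hU t ht
  intro y hy
  have h1 := mem_closedBall.mp (hc hy)
  have h2 := mem_closedBall.mp (hc hx)
  have h3 := dist_triangle_right y x c
  have h4 := dist_triangle y x M
  rw [mem_closedBall]
  linarith

theorem finite_tiles_subset_closedBall (hu : 0 < u)
    (hin : ∀ t ∈ T.tiles, ∃ c, closedBall c u ⊆ t) (M : Plane) (r : ℝ) :
    {t | t ∈ T.tiles ∧ t ⊆ closedBall M r}.Finite := by
  let A : {t | t ∈ T.tiles ∧ t ⊆ closedBall M r} → Set Plane := fun t => interior t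
  have h := MeasureTheory.Measure.finite_const_le_meas_of_disjoint_iUnion
    (MeasureTheory.volume : MeasureTheory.Measure Plane)
    (ε := MeasureTheory.volume (ball (0 : Plane) u)) (As := A)
    (measure_ball_pos _ _ hu) (fun t => isOpen_interior.measurableSet)
    (fun s t hst => Set.disjoint_iff_inter_eq_empty.mpr
      (T.interiors_disjoint s s.2.1 t t.2.1 fun h => hst (Subtype.ext h)))
    (ne_top_of_le_ne_top (MeasureTheory.measure_closedBall_lt_top (x := M) (r := r)).ne
      (MeasureTheory.measure_mono
        (Set.iUnion_subset fun t => interior_subset.trans t.2.2)))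
  have huniv : {t | MeasureTheory.volume (ball (0 : Plane) u) ≤ MeasureTheory.volume (A t)}
      = Set.univ := by
    refine Set.eq_univ_of_forall fun t => ?_
    obtain ⟨c, hc⟩ := hin t t.2.1
    rw [Set.mem_ofPred_eq, ← MeasureTheory.Measure.addHaar_ball_center MeasureTheory.volume c u]
    exact MeasureTheory.measure_mono
      (interior_maximal (ball_subset_closedBall.trans hc) isOpen_ball)
  rw [huniv, Set.finite_univ_iff] at h
  exact Set.toFinite _

theorem finite_tiles_meeting_closedBall (hu : 0 < u)
    (hin : ∀ t ∈ T.tiles, ∃ c, closedBall c u ⊆ t)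
    (hU : ∀ t ∈ T.tiles, ∃ c, t ⊆ closedBall c U) (M : Plane) (r : ℝ) :
    {t | t ∈ T.tiles ∧ (t ∩ closedBall M r).Nonempty}.Finite := by
  refine (finite_tiles_subset_closedBall hu hin M (r + 2 * U)).subset ?_
  rintro t ⟨ht, x, hxt, hx⟩
  exact ⟨ht, subset_closedBall_of_mem hU ht hxt hx⟩

/-- Near any point there are only tiles containing that point. -/
theorem eventually_mem_of_mem_tile (hu : 0 < u)
    (hin : ∀ t ∈ T.tiles, ∃ c, closedBall c u ⊆ t)
    (hU : ∀ t ∈ T.tiles, ∃ c, t ⊆ closedBall c U) (x : Plane) :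
    ∀ᶠ y in 𝓝 x, ∀ t ∈ T.tiles, y ∈ t → x ∈ t := by
  have hfin := finite_tiles_meeting_closedBall hu hin hU x 1
  have h1 : ∀ᶠ y in 𝓝 x, ∀ t ∈ {t | t ∈ T.tiles ∧ (t ∩ closedBall x 1).Nonempty},
      y ∈ t → x ∈ t := by
    rw [hfin.eventually_all]
    intro t ht
    by_cases hx : x ∈ t
    · exact Eventually.of_forall fun _ _ => hx
    · filter_upwards [(T.closed t ht.1).isOpen_compl.mem_nhds hx] with y hy hyt
      exact absurd hyt hy
  filter_upwards [h1, closedBall_mem_nhds x one_pos] with y hy hyx t ht hyt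
  exact hy t ⟨ht, y, hyt, hyx⟩ hyt

theorem connectedComponentIn_subset_tile (hu : 0 < u)
    (hin : ∀ t ∈ T.tiles, ∃ c, closedBall c u ⊆ t)
    (hU : ∀ t ∈ T.tiles, ∃ c, t ⊆ closedBall c U) {x : Plane} (hx : valence T x = 2)
    {t : Set Plane} (ht : t ∈ T.tiles) (hxt : x ∈ t) :
    connectedComponentIn {y : Plane | valence T y = 2} x ⊆ t := by
  set V := {y : Plane | valence T y = 2}
  have hnear : ∀ y ∈ V, y ∈ t → y ∈ interior (t ∪ Vᶜ) := by
    intro y hy hyt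
    rw [mem_interior_iff_mem_nhds]
    filter_upwards [eventually_mem_of_mem_tile hu hin hU y] with z hz
    by_cases hzV : z ∈ V
    · left
      have hyfin : {s | s ∈ T.tiles ∧ y ∈ s}.Finite :=
        Set.finite_of_ncard_ne_zero (ne_of_eq_of_ne (b := 2) hy two_ne_zero)
      have heq : {s | s ∈ T.tiles ∧ z ∈ s} = {s | s ∈ T.tiles ∧ y ∈ s} :=
        Set.eq_of_subset_of_ncard_le (fun s hs => ⟨hs.1, hz s hs.1 hs.2⟩)
          (le_of_eq (hy.trans hzV.symm)) hyfin
      have h : t ∈ {s | s ∈ T.tiles ∧ z ∈ s} := heq ▸ ⟨ht, hyt⟩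
      exact h.2
    · exact Or.inr hzV
  have hsub : connectedComponentIn V x ⊆ V := connectedComponentIn_subset V x
  have hpre := isPreconnected_iff_subset_of_disjoint.mp
    (isPreconnected_connectedComponentIn (F := V) (x := x)) (interior (t ∪ Vᶜ)) tᶜ
    isOpen_interior (T.closed t ht).isOpen_compl
    (fun y hy => (em (y ∈ t)).imp (hnear y (hsub hy)) id)
    (by
      rw [Set.eq_empty_iff_forall_notMem]
      rintro y ⟨hy, hyi, hyt⟩
      exact (interior_subset hyi).elim hyt fun h => h (hsub hy))
  rcases hpre with h | h
  · exact fun y hy => (interior_subset (h hy)).resolve_right fun h' => h' (hsub hy)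
  · exact absurd hxt (h (mem_connectedComponentIn hx))

theorem exists_tile_of_isTilingEdge (hu : 0 < u)
    (hin : ∀ t ∈ T.tiles, ∃ c, closedBall c u ⊆ t)
    (hU : ∀ t ∈ T.tiles, ∃ c, t ⊆ closedBall c U) {e : Set Plane} (he : IsTilingEdge T e) :
    ∃ t ∈ T.tiles, e ⊆ t := by
  obtain ⟨x, hx, rfl⟩ := he
  obtain ⟨t, ht, hxt⟩ : x ∈ ⋃₀ T.tiles := by rw [T.covers]; trivial
  exact ⟨t, ht, closure_minimal (connectedComponentIn_subset_tile hu hin hU hx ht hxt)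
    (T.closed t ht)⟩

theorem boundaryTiles_subset_closedBall (hU : ∀ t ∈ T.tiles, ∃ c, t ⊆ closedBall c U)
    (r : ℝ) (M : Plane) : ⋃₀ boundaryTiles T r M ⊆ closedBall M (r + 2 * U) := by
  refine Set.sUnion_subset ?_
  rintro t ⟨ht, ⟨x, hxt, hx⟩, -⟩
  exact subset_closedBall_of_mem hU ht hxt (le_of_eq hx)

/-- A point far from the centre lies on a ray avoiding the boundary tiles, so its component in
their complement is unbounded. -/
theorem mem_closedBall_of_isBounded_component (hU : ∀ t ∈ T.tiles, ∃ c, t ⊆ closedBall c U)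
    {r : ℝ} {M x : Plane} (hr : 0 ≤ r + 2 * U)
    (hb : Bornology.IsBounded (connectedComponentIn (⋃₀ boundaryTiles T r M)ᶜ x)) :
    x ∈ closedBall M (r + 2 * U) := by
  by_contra hx
  rw [mem_closedBall, not_le] at hx
  have hpos : 0 < ‖x - M‖ := by rw [← dist_eq_norm]; linarith
  let f : ℝ → Plane := fun s => x + s • (x - M)
  have hdist : ∀ s, 0 ≤ s → dist (f s) M = (1 + s) * ‖x - M‖ := by
    intro s hs
    have : f s - M = (1 + s) • (x - M) := by simp only [f]; module
    rw [dist_eq_norm, this, norm_smul, Real.norm_of_nonneg (by linarith)]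
  have hray : f '' Set.Ici 0 ⊆ connectedComponentIn (⋃₀ boundaryTiles T r M)ᶜ x := by
    refine IsPreconnected.subset_connectedComponentIn ?_ ⟨0, Set.self_mem_Ici, by simp [f]⟩ ?_
    · exact isPreconnected_Ici.image f (by fun_prop)
    · rintro _ ⟨s, hs, rfl⟩ hmem
      have h1 := mem_closedBall.mp (boundaryTiles_subset_closedBall hU r M hmem)
      rw [hdist s hs] at h1
      rw [dist_eq_norm] at hx
      have : 0 ≤ s * ‖x - M‖ := mul_nonneg hs hpos.le
      linarith
  obtain ⟨B, hB⟩ := (hb.subset hray).subset_closedBall M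
  have h2 := mem_closedBall.mp (hB ⟨|B| / ‖x - M‖, by simp only [Set.mem_Ici]; positivity, rfl⟩)
  rw [hdist _ (by positivity), add_mul, div_mul_cancel₀ _ hpos.ne'] at h2
  have := le_abs_self B
  linarith

theorem patch_subset (hU : ∀ t ∈ T.tiles, ∃ c, t ⊆ closedBall c U) (hU0 : 0 ≤ U)
    {r : ℝ} (hr : 0 ≤ r) (M : Plane) :
    patch T r M ⊆ {t | t ∈ T.tiles ∧ t ⊆ closedBall M (r + 2 * U)} := by
  rintro t ((⟨ht, hsub⟩ | ht) | ⟨ht, -, x, hxt, hsub, hb⟩)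
  · exact ⟨ht, hsub.trans (closedBall_subset_closedBall (by linarith))⟩
  · exact ⟨ht.1, (Set.subset_sUnion_of_mem ht).trans (boundaryTiles_subset_closedBall hU r M)⟩
  · refine ⟨ht, fun y hy => ?_⟩
    refine mem_closedBall_of_isBounded_component hU (by linarith) ?_
    rwa [← connectedComponentIn_eq (hsub hy)]

theorem subset_sUnion_patch (hU : ∀ t ∈ T.tiles, ∃ c, t ⊆ closedBall c U) {r : ℝ} {M : Plane}
    {s : Set Plane} (hs : s ⊆ closedBall M (r - 2 * U)) : s ⊆ ⋃₀ patch T r M := by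
  intro x hx
  obtain ⟨t, ht, hxt⟩ : x ∈ ⋃₀ T.tiles := by rw [T.covers]; trivial
  refine ⟨t, Or.inl (Or.inl ⟨ht, ?_⟩), hxt⟩
  have h := subset_closedBall_of_mem hU ht hxt (hs hx)
  rwa [sub_add_cancel] at h

end Bounded

end PlaneTiling

theorem exists_tendsto_div {f g : ℝ → ℝ} {a c : ℝ}
    (hf : Tendsto (fun r => f r / r ^ 2) atTop (𝓝 a))
    (hg : Tendsto (fun r => g r / r ^ 2) atTop (𝓝 c)) (hc : c ≠ 0) :
    ∃ L : ℝ, Tendsto (fun r => f r / g r) atTop (𝓝 L) := by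
  refine ⟨a / c, (hf.div hg hc).congr' ?_⟩
  filter_upwards [eventually_gt_atTop 0] with r hr
  exact div_div_div_cancel_right₀ (by positivity) _ _

/-- Every normal periodic tiling of the plane is balanced. -/
theorem normal_periodic_isBalanced (T : PlaneTiling)
    (hnorm : IsNormal T) (hper : IsPeriodic T) : IsBalanced T := by
  refine ⟨hnorm, fun M => ?_⟩
  obtain ⟨-, -, u, U, hu, huU, hT⟩ := hnorm
  have hin : ∀ t ∈ T.tiles, ∃ c, closedBall c u ⊆ t := fun t ht => (hT t ht).1
  have hU : ∀ t ∈ T.tiles, ∃ c, t ⊆ closedBall c U := fun t ht => (hT t ht).2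
  have hU0 : 0 ≤ U := hu.le.trans huU
  have hint : ∀ t ∈ T.tiles, (interior t).Nonempty := fun t ht => by
    obtain ⟨c, hc⟩ := hin t ht
    exact ⟨c, interior_mono hc (ball_subset_interior_closedBall (mem_ball_self hu))⟩
  obtain ⟨v, w, hli, hv, hw⟩ := hper
  let b : Module.Basis (Fin 2) ℝ Plane :=
    basisOfLinearIndependentOfCardEqFinrank hli (by simp)
  have hper : ∀ x ∈ Submodule.span ℤ (Set.range b), x ∈ T.periods := by
    have hle : Submodule.span ℤ (Set.range b) ≤ AddSubgroup.toIntSubmodule T.periods := by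
      rw [Submodule.span_le, coe_basisOfLinearIndependentOfCardEqFinrank]
      rintro _ ⟨i, rfl⟩
      fin_cases i
      · exact PlaneTiling.mem_periods_of_image_mem hint hv
      · exact PlaneTiling.mem_periods_of_image_mem hint hw
    exact hle
  have hpatch : ∀ r, 0 ≤ r → ⋃₀ patch T r M ⊆ closedBall M (r + 2 * U) := fun r hr =>
    Set.sUnion_subset fun t ht => (PlaneTiling.patch_subset hU hU0 hr M ht).2
  obtain ⟨ct, htiles, hct⟩ := exists_tendsto_ncard_div_sq b (X := T.tiles) (D := U) (M := M)
    (a := 2 * U) (C := fun r => patch T r M)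
    (fun t ht => (hint t ht).mono interior_subset) hU
    (fun x hx t ht => (hper x hx t ht).1)
    (fun r t ht => Or.inl (Or.inl
      ⟨ht.1, ht.2.trans (closedBall_subset_closedBall (by linarith))⟩))
    (fun r hr => PlaneTiling.patch_subset hU hU0 hr M)
  have hct : ct ≠ 0 := by
    obtain ⟨t, ht, -⟩ : (0 : Plane) ∈ ⋃₀ T.tiles := by rw [T.covers]; trivial
    exact (hct ⟨t, ht⟩ fun r => PlaneTiling.finite_tiles_subset_closedBall hu hin M r).ne'
  obtain ⟨cv, hvert, -⟩ := exists_tendsto_ncard_div_sq b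
    (X := (fun x => {x}) '' {x | IsTilingVertex T x}) (D := 0) (M := M) (a := 2 * U)
    (C := fun r => (fun x => {x}) '' {x | IsTilingVertex T x ∧ x ∈ ⋃₀ patch T r M})
    (by rintro _ ⟨x, -, rfl⟩; exact Set.singleton_nonempty x)
    (by rintro _ ⟨x, -, rfl⟩; exact ⟨x, by simp⟩)
    (by
      rintro x hx _ ⟨y, hy, rfl⟩
      refine ⟨x + y, ?_, by simp⟩
      exact hy.trans_eq (PlaneTiling.valence_add (hper x hx) y).symm)
    (by
      rintro r _ ⟨⟨x, hx, rfl⟩, hsub⟩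
      exact ⟨x, ⟨hx, PlaneTiling.subset_sUnion_patch hU hsub rfl⟩, rfl⟩)
    (by
      rintro r hr _ ⟨x, ⟨hx, hxp⟩, rfl⟩
      exact ⟨⟨x, hx, rfl⟩, Set.singleton_subset_iff.mpr (hpatch r hr hxp)⟩)
  obtain ⟨ce, hedge, -⟩ := exists_tendsto_ncard_div_sq b
    (X := {e | IsTilingEdge T e}) (D := U) (M := M) (a := 2 * U)
    (C := fun r => {e | IsTilingEdge T e ∧ e ⊆ ⋃₀ patch T r M})
    (by
      rintro _ ⟨x, hx, rfl⟩
      exact ⟨x, subset_closure (mem_connectedComponentIn hx)⟩)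
    (fun e he => by
      obtain ⟨t, ht, het⟩ := PlaneTiling.exists_tile_of_isTilingEdge hu hin hU he
      obtain ⟨c, hc⟩ := hU t ht
      exact ⟨c, het.trans hc⟩)
    (fun x hx e he => PlaneTiling.isTilingEdge_vadd (hper x hx) he)
    (fun r e he => ⟨he.1, PlaneTiling.subset_sUnion_patch hU he.2⟩)
    (fun r hr e he => ⟨he.1, he.2.trans (hpatch r hr)⟩)
  simp only [Set.ncard_image_of_injective _ Set.singleton_injective] at hvert
  exact ⟨exists_tendsto_div hvert htiles hct, exists_tendsto_div hedge htiles hct⟩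
end
end

section
/- Every normal periodic tiling of the plane is strongly balanced: for a normal tiling invariant under translations in two linearly independent directions, for every h ≥ 3 and j ≥ 3 the limits t_h(𝔗) = lim_{r→∞} t_h(r,M)/t(r,M) and v_j(𝔗) = lim_{r→∞} v_j(r,M)/t(r,M) exist (for every center point M). -/
open Filter Metric

noncomputable section

open scoped Pointwise Topology

/-! ### Counting points of periodic families -/

/-- The number of points of a planar lattice in the disk of radius `r` grows like `c * r ^ 2`. -/
lemma exists_tendsto_ncard_closedBall_inter_span (b : Module.Basis (Fin 2) ℝ Plane) :
    ∃ c : ℝ, 0 < c ∧ Tendsto (fun r : ℝ =>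
      ((closedBall (0 : Plane) r ∩ Submodule.span ℤ (Set.range b)).ncard : ℝ) / r ^ 2)
      atTop (𝓝 c) := by
  have hball : {x ∈ (Set.univ : Set Plane) | ‖x‖ ^ 2 ≤ 1} = closedBall 0 1 := by
    ext x
    simp
  have key := ZLattice.covolume.tendsto_card_le_div' (Submodule.span ℤ (Set.range b))
    (X := Set.univ) (F := fun x : Plane => ‖x‖ ^ 2) (by simp)
    (fun x r hr => by simp [norm_smul, mul_pow, abs_of_nonneg hr])
    (hball ▸ isBounded_closedBall) (hball ▸ measurableSet_closedBall)
    (hball ▸ (convex_closedBall (0 : Plane) 1).addHaar_frontier _)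
  rw [hball] at key
  refine ⟨_, ?_, (key.comp (tendsto_pow_atTop two_ne_zero)).congr' ?_⟩
  · refine div_pos (ENNReal.toReal_pos (measure_closedBall_pos _ _ one_pos).ne' ?_)
      (ZLattice.covolume_pos _ _)
    exact MeasureTheory.measure_closedBall_lt_top.ne
  · filter_upwards [eventually_ge_atTop 0] with r hr
    have : {x ∈ (Set.univ : Set Plane) | ‖x‖ ^ 2 ≤ r ^ 2} = closedBall 0 r := by
      ext x
      simp [sq_le_sq₀ (norm_nonneg x) hr]
    simp only [Function.comp_apply, this, Set.ncard_def, Set.encard, Nat.card]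
    rfl

/-- Quadratic growth is insensitive to shifting the radius. -/
lemma tendsto_add_const_div_sq {f : ℝ → ℝ} {c : ℝ}
    (hf : Tendsto (fun r => f r / r ^ 2) atTop (𝓝 c)) (C : ℝ) :
    Tendsto (fun r => f (r + C) / r ^ 2) atTop (𝓝 c) := by
  have h₁ : Tendsto (fun r => f (r + C) / (r + C) ^ 2) atTop (𝓝 c) :=
    hf.comp (tendsto_atTop_add_const_right _ C tendsto_id)
  have h₂ : Tendsto (fun r : ℝ => (1 + C * r⁻¹) ^ 2) atTop (𝓝 1) := by
    simpa using ((tendsto_inv_atTop_zero.const_mul C).const_add 1).pow 2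
  refine (by simpa using h₁.mul h₂ : Tendsto _ atTop (𝓝 c)).congr' ?_
  filter_upwards [eventually_gt_atTop 0, eventually_gt_atTop (-C)] with r hr hrC
  have : r + C ≠ 0 := by linarith
  field_simp

/-- Let `S` be a family on which a planar lattice acts, with positions `p` compatible with the
action, and with finitely many members in a fundamental domain. Then the number of members within
distance `r` of the origin, up to a bounded error in `r`, grows like a constant times `r ^ 2`. -/
lemma exists_tendsto_ncard_of_periodic {α : Type*} [AddAction Plane α]
    (b : Module.Basis (Fin 2) ℝ Plane) (S : Set α) (p : α → Plane)
    (hp : ∀ a ∈ S, ∀ g : Plane, p (g +ᵥ a) = g + p a)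
    (hS : ∀ g ∈ Submodule.span ℤ (Set.range b), ∀ a ∈ S, g +ᵥ a ∈ S)
    (hfin : {a ∈ S | p a ∈ ZSpan.fundamentalDomain b}.Finite)
    (B : ℝ → Set α) (C : ℝ)
    (hlow : ∀ r ≥ 0, ∀ a ∈ S, ‖p a‖ ≤ r - C → a ∈ B r)
    (hupp : ∀ r ≥ 0, ∀ a ∈ B r, a ∈ S ∧ ‖p a‖ ≤ r + C) :
    ∃ L : ℝ, (S.Nonempty → 0 < L) ∧
      Tendsto (fun r : ℝ => ((B r).ncard : ℝ) / r ^ 2) atTop (𝓝 L) := by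
  obtain ⟨c, hc, hcount⟩ := exists_tendsto_ncard_closedBall_inter_span b
  obtain ⟨D, hD⟩ := (ZSpan.fundamentalDomain_isBounded b).exists_norm_le
  set Λ := Submodule.span ℤ (Set.range b)
  set S₀ : Set α := {a ∈ S | p a ∈ ZSpan.fundamentalDomain b}
  set Φ : α × Plane → α := fun q => q.2 +ᵥ q.1 with hΦ
  have hrep : ∀ a ∈ S, ∃ a₀ ∈ S₀, ∃ g ∈ Λ, g +ᵥ a₀ = a := by
    intro a ha
    obtain ⟨g, hg, -⟩ := ZSpan.exist_unique_vadd_mem_fundamentalDomain b (p a)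
    refine ⟨(g : Plane) +ᵥ a, ⟨hS _ g.2 _ ha, ?_⟩, -g, neg_mem g.2, neg_vadd_vadd _ _⟩
    rw [hp a ha]
    exact hg
  have hinj : Set.InjOn Φ (S₀ ×ˢ (Λ : Set Plane)) := by
    rintro ⟨a, g⟩ ⟨ha, hg⟩ ⟨a', g'⟩ ⟨ha', hg'⟩ h
    simp only [hΦ] at h ha ha' hg hg'
    have hpos : g + p a = g' + p a' := by rw [← hp a ha.1, ← hp a' ha'.1, h]
    have huniq := (ZSpan.exist_unique_vadd_mem_fundamentalDomain b (g + p a)).unique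
      (y₁ := ⟨-g, neg_mem hg⟩) (y₂ := ⟨-g', neg_mem hg'⟩)
      (by change -g + (g + p a) ∈ _; simpa using ha.2)
      (by change -g' + (g + p a) ∈ _; simpa [hpos] using ha'.2)
    have hgg : g = g' := neg_injective (congrArg Subtype.val huniq)
    subst hgg
    rw [vadd_left_cancel g h]
  have hfinΛ : ∀ r, (closedBall (0 : Plane) r ∩ Λ).Finite := fun r =>
    ZSpan.setFinite_inter b isBounded_closedBall
  have hcard : ∀ r, (Φ '' (S₀ ×ˢ (closedBall (0 : Plane) r ∩ Λ))).ncard =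
      S₀.ncard * (closedBall (0 : Plane) r ∩ Λ).ncard := fun r => by
    rw [(hinj.mono (Set.prod_mono le_rfl Set.inter_subset_right)).ncard_image,
      Set.ncard_prod]
  have hsub_low : ∀ r ≥ 0, Φ '' (S₀ ×ˢ (closedBall (0 : Plane) (r + -(C + D)) ∩ Λ)) ⊆ B r := by
    rintro r hr _ ⟨⟨a, g⟩, ⟨ha, hgr, hg⟩, rfl⟩
    refine hlow r hr _ (hS g hg a ha.1) ?_
    rw [hp a ha.1]
    have := hD _ ha.2
    rw [mem_closedBall_zero_iff] at hgr
    linarith [norm_add_le g (p a)]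
  have hsub_upp : ∀ r ≥ 0, B r ⊆ Φ '' (S₀ ×ˢ (closedBall (0 : Plane) (r + (C + D)) ∩ Λ)) := by
    intro r hr a ha
    obtain ⟨haS, har⟩ := hupp r hr a ha
    obtain ⟨a₀, ha₀, g, hg, rfl⟩ := hrep a haS
    refine ⟨(a₀, g), ⟨ha₀, ?_, hg⟩, rfl⟩
    rw [hp a₀ ha₀.1] at har
    rw [mem_closedBall_zero_iff]
    have := hD _ ha₀.2
    have := norm_sub_le (g + p a₀) (p a₀)
    rw [add_sub_cancel_right] at this
    linarith
  have hfinB : ∀ r, (Φ '' (S₀ ×ˢ (closedBall (0 : Plane) r ∩ Λ))).Finite := fun r =>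
    (hfin.prod (hfinΛ r)).image _
  refine ⟨S₀.ncard * c, fun ⟨a, ha⟩ => ?_, ?_⟩
  · obtain ⟨a₀, ha₀, -⟩ := hrep a ha
    have : 0 < S₀.ncard := (Set.ncard_pos hfin).2 ⟨a₀, ha₀⟩
    positivity
  · have h (C' : ℝ) := (tendsto_add_const_div_sq hcount C').const_mul (S₀.ncard : ℝ)
    refine tendsto_of_tendsto_of_tendsto_of_le_of_le' (h (-(C + D))) (h (C + D))
      ?_ ?_ <;> filter_upwards [eventually_ge_atTop 0] with r hr
    · have := Set.ncard_le_ncard (hsub_low r hr) ((hfinB _).subset (hsub_upp r hr))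
      rw [hcard] at this
      simp only [← mul_div_assoc]
      gcongr
      exact_mod_cast this
    · have := Set.ncard_le_ncard (hsub_upp r hr) (hfinB _)
      rw [hcard] at this
      simp only [← mul_div_assoc]
      gcongr
      exact_mod_cast this

/-! ### Translation invariance -/

section Invariance

variable {T : PlaneTiling} {g : Plane}

lemma vadd_mem_tiles_iff (hg : g +ᵥ T.tiles = T.tiles) {t : Set Plane} :
    g +ᵥ t ∈ T.tiles ↔ t ∈ T.tiles := by
  conv_lhs => rw [← hg]
  exact Set.vadd_mem_vadd_set_iff

lemma valence_vadd (hg : g +ᵥ T.tiles = T.tiles) (x : Plane) :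
    valence T (g +ᵥ x) = valence T x := by
  have : {t | t ∈ T.tiles ∧ g +ᵥ x ∈ t} = g +ᵥ {t | t ∈ T.tiles ∧ x ∈ t} := by
    ext t
    rw [Set.mem_vadd_set_iff_neg_vadd_mem]
    have := vadd_mem_tiles_iff hg (t := -g +ᵥ t)
    rw [vadd_neg_vadd] at this
    simp [this, Set.mem_vadd_set_iff_neg_vadd_mem]
  rw [valence, this, Set.ncard_vadd_set, valence]

lemma IsTilingEdge.vadd (hg : g +ᵥ T.tiles = T.tiles) {e : Set Plane} (he : IsTilingEdge T e) :
    IsTilingEdge T (g +ᵥ e) := by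
  obtain ⟨x, hx, rfl⟩ := he
  refine ⟨g +ᵥ x, (valence_vadd hg x).trans hx, ?_⟩
  have himage : Homeomorph.vadd g '' {y | valence T y = 2} = {y | valence T y = 2} := by
    ext y
    refine ⟨?_, fun hy => ⟨-g +ᵥ y, ?_, vadd_neg_vadd g y⟩⟩
    · rintro ⟨z, hz, rfl⟩
      exact (valence_vadd hg z).trans hz
    · change valence T (-g +ᵥ y) = 2
      rwa [← valence_vadd hg, vadd_neg_vadd]
  have := (Homeomorph.vadd g).image_connectedComponentIn (s := {y | valence T y = 2}) hx
  rw [himage] at this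
  change Homeomorph.vadd g '' _ = _
  rw [Homeomorph.image_closure, this]
  rfl

lemma Adjacent.vadd (hg : g +ᵥ T.tiles = T.tiles) {t t' : Set Plane} (h : Adjacent T t t') :
    Adjacent T (g +ᵥ t) (g +ᵥ t') := by
  obtain ⟨ht, ht', hne, e, he, het, het'⟩ := h
  exact ⟨(vadd_mem_tiles_iff hg).2 ht, (vadd_mem_tiles_iff hg).2 ht',
    fun h => hne (vadd_left_cancel g h), g +ᵥ e, he.vadd hg,
    Set.vadd_set_mono het, Set.vadd_set_mono het'⟩

lemma numAdjacents_vadd (hg : g +ᵥ T.tiles = T.tiles) (t : Set Plane) :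
    numAdjacents T (g +ᵥ t) = numAdjacents T t := by
  have : {t' | Adjacent T (g +ᵥ t) t'} = g +ᵥ {t' | Adjacent T t t'} := by
    ext t'
    rw [Set.mem_vadd_set_iff_neg_vadd_mem]
    refine ⟨fun h => ?_, fun h => ?_⟩
    · simpa using Adjacent.vadd (neg_vadd_eq_iff.2 hg.symm) h
    · simpa using Adjacent.vadd hg h
  rw [numAdjacents, this, Set.ncard_vadd_set, numAdjacents]

/-- A translation mapping tiles to tiles permutes the tiles, provided these have interior points. -/
lemma vadd_tiles_eq_of_forall_mem (hint : ∀ t ∈ T.tiles, (interior t).Nonempty)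
    (hg : ∀ t ∈ T.tiles, (fun x => x + g) '' t ∈ T.tiles) : g +ᵥ T.tiles = T.tiles := by
  have hg' : ∀ t ∈ T.tiles, g +ᵥ t ∈ T.tiles := fun t ht => by
    have : g +ᵥ t = (fun x => x + g) '' t := by
      simp only [add_comm _ g]
      rfl
    exact this ▸ hg t ht
  refine Set.Subset.antisymm ?_ fun t ht => ?_
  · rintro _ ⟨t, ht, rfl⟩
    exact hg' t ht
  have : Countable T.tiles := T.countable
  have hdense : Dense (⋃ s : T.tiles, interior (g +ᵥ (s : Set Plane))) := by
    refine dense_iUnion_interior_of_closed (fun s => T.closed _ (hg' s s.2)) ?_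
    refine Set.eq_univ_of_forall fun x => ?_
    obtain ⟨s, hs, hx⟩ : -g +ᵥ x ∈ ⋃₀ T.tiles := T.covers ▸ Set.mem_univ _
    exact Set.mem_iUnion.2 ⟨⟨s, hs⟩, Set.mem_vadd_set_iff_neg_vadd_mem.2 hx⟩
  obtain ⟨x, hxt, hx⟩ := hdense.inter_open_nonempty _ isOpen_interior (hint t ht)
  obtain ⟨⟨s, hs⟩, hxs⟩ := Set.mem_iUnion.1 hx
  have hst : g +ᵥ s = t := by
    by_contra hne
    have := T.interiors_disjoint _ (hg' s hs) t ht hne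
    exact this.le ⟨hxs, hxt⟩
  exact ⟨s, hs, hst⟩

end Invariance

/-- A periodic tiling is invariant under a lattice of translations. -/
lemma IsPeriodic.exists_basis {T : PlaneTiling} (hper : IsPeriodic T)
    (hint : ∀ t ∈ T.tiles, (interior t).Nonempty) :
    ∃ b : Module.Basis (Fin 2) ℝ Plane,
      ∀ g ∈ Submodule.span ℤ (Set.range b), g +ᵥ T.tiles = T.tiles := by
  obtain ⟨v, w, hvw, hv, hw⟩ := hper
  let b := basisOfLinearIndependentOfCardEqFinrank hvw (by simp)
  refine ⟨b, fun g hg => ?_⟩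
  have hle : Submodule.span ℤ (Set.range b) ≤
      AddSubgroup.toIntSubmodule (AddAction.stabilizer Plane T.tiles) := by
    rw [Submodule.span_le]
    rintro _ ⟨i, rfl⟩
    change b i +ᵥ T.tiles = T.tiles
    rw [coe_basisOfLinearIndependentOfCardEqFinrank]
    fin_cases i
    · exact vadd_tiles_eq_of_forall_mem hint hv
    · exact vadd_tiles_eq_of_forall_mem hint hw
  exact hle hg

/-! ### Patches and disks -/

/-- In the plane, the complement of a disk is connected. -/
lemma isPreconnected_compl_closedBall (M : Plane) {R : ℝ} (hR : 0 ≤ R) :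
    IsPreconnected (closedBall M R)ᶜ := by
  have hrank : 1 < Module.rank ℝ Plane := Module.one_lt_rank_of_one_lt_finrank (by simp)
  have hconn : IsPreconnected (sphere (0 : Plane) 1 ×ˢ Set.Ioi R) :=
    (isPreconnected_sphere hrank 0 1).prod isPreconnected_Ioi
  have himage : (closedBall M R)ᶜ =
      (fun q : Plane × ℝ => M + q.2 • q.1) '' (sphere (0 : Plane) 1 ×ˢ Set.Ioi R) := by
    ext x
    simp only [Set.mem_compl_iff, mem_closedBall, not_le, dist_eq_norm]
    constructor
    · intro hx
      have hpos : 0 < ‖x - M‖ := hR.trans_lt hx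
      refine ⟨(‖x - M‖⁻¹ • (x - M), ‖x - M‖), ⟨?_, hx⟩, ?_⟩
      · simp [norm_smul, hpos.ne']
      · simp [smul_smul, hpos.ne']
    · rintro ⟨⟨y, s⟩, ⟨hy, hs⟩, rfl⟩
      simp only [mem_sphere_zero_iff_norm, Set.mem_Ioi] at hy hs
      simpa [norm_smul, hy] using hs.trans_le (le_abs_self s)
  rw [himage]
  exact hconn.image _ (by fun_prop)

section Patch

variable {T : PlaneTiling} {d : ℝ}

lemma subset_closedBall_of_mem_patch (hd : ∀ t ∈ T.tiles, ∀ x ∈ t, ∀ y ∈ t, dist x y ≤ d)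
    (hd₀ : 0 ≤ d) {r : ℝ} (hr : 0 ≤ r) {M : Plane} {t : Set Plane} (ht : t ∈ patch T r M) :
    t ⊆ closedBall M (r + d) := by
  have hbdry : ∀ s ∈ boundaryTiles T r M, s ⊆ closedBall M (r + d) := by
    rintro s ⟨hs, ⟨y, hys, hy⟩, -⟩ x hx
    have := hd s hs x hx y hys
    rw [mem_sphere] at hy
    rw [mem_closedBall]
    linarith [dist_triangle x y M]
  rcases ht with (⟨-, ht⟩ | ht) | ⟨-, -, x, -, ht, hbdd⟩
  · exact ht.trans (closedBall_subset_closedBall (by linarith))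
  · exact hbdry t ht
  · by_contra hnot
    obtain ⟨y, hyt, hy⟩ := Set.not_subset.1 hnot
    have hsub : (closedBall M (r + d))ᶜ ⊆ (⋃₀ boundaryTiles T r M)ᶜ :=
      Set.compl_subset_compl.2 (Set.sUnion_subset hbdry)
    have hcomp := (isPreconnected_compl_closedBall M (R := r + d)
      (by positivity)).subset_connectedComponentIn hy hsub
    rw [← connectedComponentIn_eq (ht hyt)] at hcomp
    refine NormedSpace.unbounded_univ ℝ Plane ?_
    rw [← Set.compl_union_self (closedBall M (r + d))]
    exact (hbdd.subset hcomp).union isBounded_closedBall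

lemma mem_tiles_of_mem_patch {r : ℝ} {M : Plane} {t : Set Plane} (ht : t ∈ patch T r M) :
    t ∈ T.tiles := by
  rcases ht with (ht | ht) | ht <;> exact ht.1

lemma mem_patch_of_mem_closedBall (hd : ∀ t ∈ T.tiles, ∀ x ∈ t, ∀ y ∈ t, dist x y ≤ d)
    {r : ℝ} {M : Plane} {t : Set Plane} (ht : t ∈ T.tiles) {x : Plane} (hx : x ∈ t)
    (hxM : dist x M ≤ r - d) : t ∈ patch T r M := by
  refine Or.inl (Or.inl ⟨ht, fun y hy => ?_⟩)
  rw [mem_closedBall]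
  linarith [dist_triangle y x M, hd t ht y hy x hx]

end Patch

/-- Only finitely many tiles containing a disk of radius `u` fit into a bounded region. -/
lemma finite_tiles_subset_closedBall {T : PlaneTiling} {u : ℝ} (hu : 0 < u)
    (hin : ∀ t ∈ T.tiles, ∃ c, closedBall c u ⊆ t) (R : ℝ) :
    {t | t ∈ T.tiles ∧ t ⊆ closedBall (0 : Plane) R}.Finite := by
  set I : Set (Set Plane) := {t | t ∈ T.tiles ∧ t ⊆ closedBall (0 : Plane) R} with hI
  have hfin := MeasureTheory.Measure.finite_const_le_meas_of_disjoint_iUnion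
    (MeasureTheory.volume : MeasureTheory.Measure Plane)
    (measure_ball_pos MeasureTheory.volume (0 : Plane) hu)
    (As := fun t : I => interior (t : Set Plane)) (fun t => isOpen_interior.measurableSet)
    (fun s t hst => Set.disjoint_iff_inter_eq_empty.2 <|
      T.interiors_disjoint s s.2.1 t t.2.1 (Subtype.coe_injective.ne hst))
    (ne_top_of_le_ne_top (MeasureTheory.measure_closedBall_lt_top (x := (0 : Plane)) (r := R)).ne
      (MeasureTheory.measure_mono (Set.iUnion_subset fun t => interior_subset.trans t.2.2)))
  have huniv : (Set.univ : Set I).Finite := by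
    refine hfin.subset fun t _ => ?_
    obtain ⟨c, hc⟩ := hin t t.2.1
    change _ ≤ MeasureTheory.volume (interior (t : Set Plane))
    rw [MeasureTheory.Measure.addHaar_ball_center, ← MeasureTheory.Measure.addHaar_ball_center _ c]
    exact MeasureTheory.measure_mono
      (interior_maximal (ball_subset_closedBall.trans hc) isOpen_ball)
  exact Set.finite_univ_iff.1 huniv

/-! ### Positions of tiles -/

/-- The lower left corner of the bounding box of a planar set. -/
def boxCorner (t : Set Plane) : Plane := !₂[sInf ((fun x : Plane => x 0) '' t),
  sInf ((fun x : Plane => x 1) '' t)]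

lemma boxCorner_apply (t : Set Plane) (i : Fin 2) :
    boxCorner t i = sInf ((fun x : Plane => x i) '' t) := by
  fin_cases i <;> rfl

lemma boxCorner_vadd {t : Set Plane} (hne : t.Nonempty) (hbdd : Bornology.IsBounded t)
    (g : Plane) : boxCorner (g +ᵥ t) = g + boxCorner t := by
  ext i
  have hbelow : BddBelow ((fun x : Plane => x i) '' t) := by
    obtain ⟨R, hR⟩ := hbdd.exists_norm_le
    refine ⟨-R, ?_⟩
    rintro _ ⟨x, hx, rfl⟩
    exact (abs_le.1 ((PiLp.norm_apply_le x i).trans (hR x hx))).1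
  have himage : (fun x : Plane => x i) '' (g +ᵥ t) = {g i} + (fun x : Plane => x i) '' t := by
    rw [Set.singleton_add, Set.image_image]
    exact Set.image_image _ _ _
  rw [PiLp.add_apply, boxCorner_apply, boxCorner_apply, himage,
    csInf_add (Set.singleton_nonempty _) (bddBelow_singleton) (hne.image _) hbelow,
    csInf_singleton]

lemma dist_boxCorner_le {t : Set Plane} {d : ℝ} (hd : ∀ x ∈ t, ∀ y ∈ t, dist x y ≤ d)
    {x : Plane} (hx : x ∈ t) : dist x (boxCorner t) ≤ 2 * d := by
  have hcoord : ∀ i, |(x - boxCorner t) i| ≤ d := fun i => by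
    have hlow : ∀ z ∈ (fun y : Plane => y i) '' t, x i - d ≤ z := by
      rintro _ ⟨y, hy, rfl⟩
      have := (PiLp.norm_apply_le (x - y) i).trans (dist_eq_norm x y ▸ hd x hx y hy)
      rw [PiLp.sub_apply, Real.norm_eq_abs] at this
      linarith [(abs_le.1 this).2]
    have h₁ : x i - d ≤ boxCorner t i := by
      rw [boxCorner_apply]
      exact le_csInf (Set.Nonempty.image _ ⟨x, hx⟩) hlow
    have h₂ : boxCorner t i ≤ x i := by
      rw [boxCorner_apply]
      exact csInf_le ⟨_, hlow⟩ ⟨x, hx, rfl⟩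
    rw [PiLp.sub_apply, abs_le]
    constructor <;> linarith
  have hd₀ : 0 ≤ d := (abs_nonneg _).trans (hcoord 0)
  rw [dist_eq_norm, EuclideanSpace.norm_eq, Fin.sum_univ_two]
  refine Real.sqrt_le_iff.2 ⟨by linarith, ?_⟩
  have h₀ := pow_le_pow_left₀ (abs_nonneg _) (hcoord 0) 2
  have h₁ := pow_le_pow_left₀ (abs_nonneg _) (hcoord 1) 2
  simp only [Real.norm_eq_abs]
  nlinarith

/-- Every normal periodic tiling of the plane is strongly balanced. -/
theorem normal_periodic_isStronglyBalanced (T : PlaneTiling)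
    (hnorm : IsNormal T) (hper : IsPeriodic T) : IsStronglyBalanced T := by
  obtain ⟨u, U, hu, huU, hball⟩ := hnorm.2.2
  have hd : ∀ t ∈ T.tiles, ∀ x ∈ t, ∀ y ∈ t, dist x y ≤ 2 * U := fun t ht x hx y hy => by
    obtain ⟨c, hc⟩ := (hball t ht).2
    have hx' := mem_closedBall.1 (hc hx)
    have hy' := mem_closedBall.1 (hc hy)
    linarith [dist_triangle_right x y c]
  have hd₀ : 0 ≤ 2 * U := by linarith
  have hne : ∀ t ∈ T.tiles, t.Nonempty := fun t ht => by
    obtain ⟨c, hc⟩ := (hball t ht).1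
    exact ⟨c, hc (mem_closedBall_self hu.le)⟩
  have hint : ∀ t ∈ T.tiles, (interior t).Nonempty := fun t ht => by
    obtain ⟨c, hc⟩ := (hball t ht).1
    exact ⟨c, interior_maximal (ball_subset_closedBall.trans hc) isOpen_ball (mem_ball_self hu)⟩
  have hbdd : ∀ t ∈ T.tiles, Bornology.IsBounded t := fun t ht => by
    obtain ⟨c, hc⟩ := (hball t ht).2
    exact isBounded_closedBall.subset hc
  obtain ⟨b, hb⟩ := hper.exists_basis hint
  have hfin : {t ∈ T.tiles | boxCorner t ∈ ZSpan.fundamentalDomain b}.Finite := by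
    obtain ⟨D, hD⟩ := (ZSpan.fundamentalDomain_isBounded b).exists_norm_le
    refine (finite_tiles_subset_closedBall hu (fun t ht => (hball t ht).1)
      (D + 2 * (2 * U))).subset fun t ht => ⟨ht.1, fun x hx => ?_⟩
    have h₁ := dist_boxCorner_le (hd t ht.1) hx
    have h₂ := hD _ ht.2
    rw [← dist_zero_right] at h₂
    rw [mem_closedBall]
    linarith [dist_triangle x (boxCorner t) 0]
  -- Every translation invariant class of tiles has a density.
  have htiles : ∀ P : Set Plane → Prop,
      (∀ g : Plane, g +ᵥ T.tiles = T.tiles → ∀ t, P t → P (g +ᵥ t)) → ∀ M : Plane,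
      ∃ L : ℝ, ({t ∈ T.tiles | P t}.Nonempty → 0 < L) ∧
        Tendsto (fun r : ℝ => ({t | t ∈ patch T r M ∧ P t}.ncard : ℝ) / r ^ 2)
          atTop (𝓝 L) := by
    intro P hP M
    refine exists_tendsto_ncard_of_periodic b {t ∈ T.tiles | P t} boxCorner
      (fun t ht g => boxCorner_vadd (hne t ht.1) (hbdd t ht.1) g)
      (fun g hg t ht => ⟨(vadd_mem_tiles_iff (hb g hg)).2 ht.1, hP g (hb g hg) t ht.2⟩)
      (hfin.subset fun t ht => ⟨ht.1.1, ht.2⟩)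
      (fun r => {t | t ∈ patch T r M ∧ P t}) (‖M‖ + 3 * (2 * U)) ?_ ?_
    · rintro r - t ⟨ht, hPt⟩ htr
      obtain ⟨x, hx⟩ := hne t ht
      refine ⟨mem_patch_of_mem_closedBall hd ht hx ?_, hPt⟩
      have := dist_boxCorner_le (hd t ht) hx
      linarith [dist_triangle x (boxCorner t) M, dist_le_norm_add_norm (boxCorner t) M]
    · rintro r hr t ⟨ht, hPt⟩
      have htT := mem_tiles_of_mem_patch ht
      obtain ⟨x, hx⟩ := hne t htT
      refine ⟨⟨htT, hPt⟩, ?_⟩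
      have h₁ := dist_boxCorner_le (hd t htT) hx
      have h₂ := mem_closedBall.1 (subset_closedBall_of_mem_patch hd hd₀ hr ht hx)
      rw [dist_comm] at h₁
      simp only [← dist_zero_right]
      linarith [dist_triangle (boxCorner t) x 0, dist_triangle x M 0]
  refine ⟨hnorm, fun M n _ => ?_⟩
  obtain ⟨L, hL, hlim⟩ := htiles (fun _ => True) (fun _ _ _ _ => trivial) M
  simp only [and_true, Set.ofPred_mem_eq] at hlim
  have hL₀ : L ≠ 0 := by
    obtain ⟨t, ht, -⟩ : (0 : Plane) ∈ ⋃₀ T.tiles := T.covers ▸ Set.mem_univ _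
    exact (hL ⟨t, ht, trivial⟩).ne'
  have hratio : ∀ {N : ℝ → ℝ} {K : ℝ}, Tendsto (fun r => N r / r ^ 2) atTop (𝓝 K) →
      ∃ K' : ℝ, Tendsto (fun r => N r / (tCount T r M : ℝ)) atTop (𝓝 K') := by
    intro N K hN
    refine ⟨K / L, (hN.div hlim hL₀).congr' ?_⟩
    filter_upwards [eventually_gt_atTop 0] with r hr
    exact div_div_div_cancel_right₀ (by positivity) _ _
  constructor
  · obtain ⟨K, -, hK⟩ := htiles (fun t => numAdjacents T t = n)
      (fun g hg t ht => (numAdjacents_vadd hg t).trans ht) M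
    exact hratio hK
  have hmem : ∀ x : Plane, ∀ r, ‖x‖ ≤ r - (‖M‖ + 2 * U) → x ∈ ⋃₀ patch T r M := by
    intro x r hx
    obtain ⟨t, ht, hxt⟩ : x ∈ ⋃₀ T.tiles := T.covers ▸ Set.mem_univ _
    exact ⟨t, mem_patch_of_mem_closedBall hd ht hxt
      (by linarith [dist_le_norm_add_norm x M]), hxt⟩
  by_cases hvfin : {x ∈ {x | valence T x = n} | x ∈ ZSpan.fundamentalDomain b}.Finite
  · obtain ⟨K, -, hK⟩ := exists_tendsto_ncard_of_periodic b {x | valence T x = n} id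
      (fun _ _ _ => rfl) (fun g hg x hx => (valence_vadd (hb g hg) x).trans hx) hvfin
      (fun r => {x | valence T x = n ∧ x ∈ ⋃₀ patch T r M}) (‖M‖ + 2 * U)
      (fun r _ x hx hxr => ⟨hx, hmem x r hxr⟩) (by
        rintro r hr x ⟨hx, t, ht, hxt⟩
        refine ⟨hx, ?_⟩
        have := mem_closedBall.1 (subset_closedBall_of_mem_patch hd hd₀ hr ht hxt)
        have h := norm_le_norm_add_norm_sub' x M
        rw [← dist_eq_norm] at h
        simp only [id]
        linarith)
    exact hratio hK
  · -- Here the patches eventually contain infinitely many points of valence `n`.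
    obtain ⟨D, hD⟩ := (ZSpan.fundamentalDomain_isBounded b).exists_norm_le
    refine ⟨0, tendsto_const_nhds.congr' ?_⟩
    filter_upwards [eventually_ge_atTop (D + (‖M‖ + 2 * U))] with r hr
    have hinf : {x | valence T x = n ∧ x ∈ ⋃₀ patch T r M}.Infinite :=
      Set.Infinite.mono (fun x hx => ⟨hx.1, hmem x r (by linarith [hD x hx.2])⟩) hvfin
    rw [vjCount, hinf.ncard, Nat.cast_zero, zero_div]
end
end

section
/- For every strongly balanced tiling 𝔗 of the plane by isometric copies of a single convex pentagon, the average valence of the vertices satisfies 3 ≤ Σ_{j≥3} j·w_j(𝔗) ≤ 10/3, where w_j(𝔗) = v_j(𝔗)/v(𝔗) and v(𝔗) = Σ_{j≥3} v_j(𝔗). -/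
open Filter Metric

noncomputable section

open MeasureTheory

/-- The linear functional `x ↦ cross2 x v`. -/
def crossLeft (v : Plane) : Plane →ₗ[ℝ] ℝ where
  toFun x := cross2 x v
  map_add' x y := by simp [cross2]; ring
  map_smul' c x := by simp [cross2]; ring

lemma crossLeft_apply (v x : Plane) : crossLeft v x = x 0 * v 1 - x 1 * v 0 := rfl

lemma exists_eq_smul_of_cross_eq_zero {v z : Plane} (hv : v ≠ 0) (h : crossLeft v z = 0) :
    ∃ c : ℝ, z = c • v := by
  rw [crossLeft_apply] at h
  by_cases h0 : v 0 = 0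
  · have h1 : v 1 ≠ 0 := by
      intro h1
      apply hv
      ext i
      fin_cases i <;> simp [h0, h1]
    refine ⟨z 1 / v 1, ?_⟩
    ext i
    fin_cases i
    · have : z 0 * v 1 = 0 := by rw [h0] at h; linarith
      simp [h0, (mul_eq_zero.1 this).resolve_right h1]
    · simp [h1]
  · refine ⟨z 0 / v 0, ?_⟩
    ext i
    fin_cases i
    · simp [h0]
    · simp only [Fin.mk_one, PiLp.smul_apply, smul_eq_mul]
      field_simp
      linarith

lemma volume_crossLeft_eq_zero {w : Plane} (hw : w ≠ 0) :
    volume {v : Plane | crossLeft v w = 0} = 0 := by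
  have hset : {v : Plane | crossLeft v w = 0} = (LinearMap.ker (crossLeft w) : Set Plane) := by
    ext v
    simp only [Set.mem_ofPred_eq, SetLike.mem_coe, LinearMap.mem_ker, crossLeft_apply]
    constructor <;> intro h <;> linarith
  rw [hset]
  apply Measure.addHaar_submodule
  intro htop
  apply hw
  have h0 : (!₂[1, 0] : Plane) ∈ LinearMap.ker (crossLeft w) := htop ▸ Submodule.mem_top
  have h1 : (!₂[0, 1] : Plane) ∈ LinearMap.ker (crossLeft w) := htop ▸ Submodule.mem_top
  simp [crossLeft_apply] at h0 h1
  ext i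
  fin_cases i <;> simp [h0, h1]

lemma volumeReal_closedBall (x : Plane) {r : ℝ} (hr : 0 ≤ r) :
    volume.real (closedBall x r) = r ^ 2 * volume.real (ball (0 : Plane) 1) := by
  rw [Measure.addHaar_real_closedBall _ _ hr]
  simp

lemma volumeReal_unitBall_pos : 0 < volume.real (ball (0 : Plane) 1) :=
  ENNReal.toReal_pos (measure_ball_pos volume _ one_pos).ne' measure_ball_lt_top.ne

/-- The density of a convex set around one of its points increases when the radius shrinks. -/
lemma sq_mul_volume_inter_closedBall_le {t : Set Plane} (ht : Convex ℝ t) {x : Plane}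
    (hx : x ∈ t) {ε ε₀ : ℝ} (hε : 0 < ε) (hle : ε ≤ ε₀) :
    (ε / ε₀) ^ 2 * volume.real (t ∩ closedBall x ε₀) ≤ volume.real (t ∩ closedBall x ε) := by
  have hε₀ : 0 < ε₀ := hε.trans_le hle
  have hfin : volume (t ∩ closedBall x ε) ≠ ⊤ :=
    measure_ne_top_of_subset Set.inter_subset_right measure_closedBall_lt_top.ne
  have hsub : AffineMap.homothety x (ε / ε₀) '' (t ∩ closedBall x ε₀) ⊆
      t ∩ closedBall x ε := by
    rintro _ ⟨y, ⟨hyt, hyb⟩, rfl⟩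
    refine ⟨?_, ?_⟩
    · rw [AffineMap.homothety_eq_lineMap]
      exact ht.lineMap_mem hx hyt ⟨by positivity, (div_le_one hε₀).2 hle⟩
    · rw [mem_closedBall, dist_homothety_center, Real.norm_of_nonneg (by positivity)]
      rw [mem_closedBall, dist_comm] at hyb
      calc ε / ε₀ * dist x y ≤ ε / ε₀ * ε₀ := by gcongr
        _ = ε := by field_simp
  have h := measureReal_mono hsub hfin
  rw [measureReal_def, Measure.addHaar_image_homothety, ENNReal.toReal_mul,
    ENNReal.toReal_ofReal (abs_nonneg _), finrank_euclideanSpace_fin,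
    abs_of_nonneg (by positivity)] at h
  exact h

/-- If for almost every small `v` at least `N` of the points `x i ± v` lie in `t`, then the total
area of `t` around the points `x i` is at least `N / 2` disks. -/
lemma card_mul_volume_le_two_mul_sum {ι : Type*} [Fintype ι] {t : Set Plane} (ht : IsClosed t)
    (x : ι → Plane) (N : ℕ) {ε : ℝ}
    (h : ∀ᵐ v : Plane, v ∈ closedBall (0 : Plane) ε →
      N ≤ {i | x i + v ∈ t}.ncard + {i | x i - v ∈ t}.ncard) :
    N * volume.real (closedBall (0 : Plane) ε) ≤
      2 * ∑ i, volume.real (t ∩ closedBall (x i) ε) := by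
  classical
  set B := closedBall (0 : Plane) ε with hB
  let P : ι → Set Plane := fun i => {v | x i + v ∈ t}
  let Q : ι → Set Plane := fun i => {v | x i - v ∈ t}
  have hP : ∀ i, MeasurableSet (P i) := fun i =>
    (ht.preimage (f := fun v => x i + v) (by fun_prop)).measurableSet
  have hQ : ∀ i, MeasurableSet (Q i) := fun i =>
    (ht.preimage (f := fun v => x i - v) (by fun_prop)).measurableSet
  have hPv : ∀ i, volume (P i ∩ B) = volume (t ∩ closedBall (x i) ε) := by
    intro i
    rw [← measure_preimage_add volume (x i) (t ∩ closedBall (x i) ε)]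
    congr 1
    ext v
    simp [P, hB]
  have hQv : ∀ i, volume (Q i ∩ B) = volume (t ∩ closedBall (x i) ε) := by
    intro i
    rw [← (Measure.measurePreserving_sub_left volume (x i)).measure_preimage
      (ht.inter isClosed_closedBall).measurableSet.nullMeasurableSet]
    congr 1
    ext v
    simp [Q, hB, dist_eq_norm]
  have key : ∫⁻ _ in B, (N : ENNReal) ≤
      ∫⁻ v in B, ∑ i, ((P i).indicator 1 v + (Q i).indicator 1 v) := by
    apply setLIntegral_mono_ae
    · exact (Finset.measurable_sum _ fun i _ => (measurable_one.indicator (hP i)).add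
        (measurable_one.indicator (hQ i))).aemeasurable
    · filter_upwards [h] with v hv hvB
      have hn := hv hvB
      rw [Finset.sum_add_distrib]
      have e : ∀ R : ι → Set Plane, ∑ i, (R i).indicator (1 : Plane → ENNReal) v =
          (({i | v ∈ R i} : Set ι).ncard : ENNReal) := by
        intro R
        rw [Set.ncard_eq_toFinset_card']
        simp [Set.indicator_apply]
      rw [e, e]
      exact_mod_cast hn
  have hmeas : ∀ i ∈ Finset.univ, Measurable
      fun v : Plane => (P i).indicator (1 : Plane → ENNReal) v + (Q i).indicator 1 v := fun i _ =>
    (measurable_one.indicator (hP i)).add (measurable_one.indicator (hQ i))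
  rw [lintegral_finsetSum _ hmeas, setLIntegral_const] at key
  have hsum : ∀ i, ∫⁻ v in B, ((P i).indicator 1 v + (Q i).indicator 1 v) =
      2 * volume (t ∩ closedBall (x i) ε) := by
    intro i
    rw [lintegral_add_left (measurable_one.indicator (hP i)), lintegral_indicator_one (hP i),
      lintegral_indicator_one (hQ i), Measure.restrict_apply (hP i),
      Measure.restrict_apply (hQ i), hPv, hQv, two_mul]
  simp_rw [hsum] at key
  have hfin : ∀ i, volume (t ∩ closedBall (x i) ε) ≠ ⊤ := fun i =>
    measure_ne_top_of_subset Set.inter_subset_right measure_closedBall_lt_top.ne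
  have h2 : ∀ i ∈ Finset.univ, 2 * volume (t ∩ closedBall (x i) ε) ≠ ⊤ := fun i _ =>
    ENNReal.mul_ne_top (by simp) (hfin i)
  have h3 := ENNReal.toReal_mono (ENNReal.sum_ne_top.2 h2) key
  rw [ENNReal.toReal_sum h2, ENNReal.toReal_mul] at h3
  simpa [ENNReal.toReal_mul, measureReal_def, Finset.mul_sum] using h3

/-- If the line through `q i` in direction `v` separates two other points of the family, then it
meets the convex hull of the family on one side of `q i`, at distance more than `‖v‖`. -/
lemma add_mem_or_sub_mem_convexHull {ι : Type*} {q : ι → Plane} {i a b : ι} {v : Plane}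
    (hv : v ≠ 0) (hdist : ∀ z ∈ convexHull ℝ (q '' {i}ᶜ), ‖v‖ < dist z (q i))
    (ha : crossLeft v (q a) < crossLeft v (q i)) (hb : crossLeft v (q i) < crossLeft v (q b)) :
    q i + v ∈ convexHull ℝ (Set.range q) ∨ q i - v ∈ convexHull ℝ (Set.range q) := by
  set f := crossLeft v with hf
  have hai : a ≠ i := by rintro rfl; exact lt_irrefl _ ha
  have hbi : b ≠ i := by rintro rfl; exact lt_irrefl _ hb
  have hconv := convex_convexHull ℝ (q '' {i}ᶜ)
  have hab : 0 < f (q b) - f (q a) := by linarith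
  set s : ℝ := (f (q i) - f (q a)) / (f (q b) - f (q a)) with hs
  have hs0 : 0 ≤ s := div_nonneg (by linarith) hab.le
  have hs1 : s ≤ 1 := (div_le_one hab).2 (by linarith)
  set z : Plane := (1 - s) • q a + s • q b with hz
  have hzmem : z ∈ convexHull ℝ (q '' {i}ᶜ) :=
    hconv (subset_convexHull ℝ _ ⟨a, hai, rfl⟩) (subset_convexHull ℝ _ ⟨b, hbi, rfl⟩)
      (by linarith) hs0 (by ring)
  have hfz : f (z - q i) = 0 := by
    have : s * (f (q b) - f (q a)) = f (q i) - f (q a) := div_mul_cancel₀ _ hab.ne'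
    rw [hz, map_sub, map_add, map_smul, map_smul, smul_eq_mul, smul_eq_mul]
    linarith
  obtain ⟨c, hc⟩ := exists_eq_smul_of_cross_eq_zero hv hfz
  have hvn : 0 < ‖v‖ := norm_pos_iff.2 hv
  have hc1 : 1 < |c| := by
    have h := hdist z hzmem
    rw [dist_eq_norm, hc, norm_smul, Real.norm_eq_abs] at h
    by_contra hle
    nlinarith
  have hzP : z ∈ convexHull ℝ (Set.range q) := convexHull_mono (Set.image_subset_range _ _) hzmem
  have hqP : q i ∈ convexHull ℝ (Set.range q) := subset_convexHull ℝ _ ⟨i, rfl⟩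
  have hseg : q i + |c|⁻¹ • (z - q i) ∈ convexHull ℝ (Set.range q) :=
    (convex_convexHull ℝ _).add_smul_sub_mem hqP hzP
      ⟨by positivity, inv_le_one_of_one_le₀ hc1.le⟩
  rw [hc, smul_smul] at hseg
  rcases abs_cases c with ⟨h, _⟩ | ⟨h, _⟩
  · left
    rw [h] at hseg hc1
    rwa [inv_mul_cancel₀ (by linarith), one_smul] at hseg
  · right
    rw [h] at hseg hc1
    rwa [inv_neg, neg_mul, inv_mul_cancel₀ (by linarith), neg_smul, one_smul,
      ← sub_eq_add_neg] at hseg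

/-- Around its five corners, a convex pentagon covers in total at least one and a half disks. -/
lemma exists_three_mul_volume_le_corners {q : Fin 5 → Plane} (hq : ConvexIndependent ℝ q) :
    ∃ ε > 0, 3 * volume.real (closedBall (0 : Plane) ε) ≤
      2 * ∑ i, volume.real (convexHull ℝ (Set.range q) ∩ closedBall (q i) ε) := by
  have hcomp : ∀ s : Set (Fin 5), IsCompact (convexHull ℝ (q '' s)) := fun s =>
    (s.toFinite.image q).isCompact_convexHull (𝕜 := ℝ)
  have hdist : ∀ i, ∃ ε > 0, ∀ z ∈ convexHull ℝ (q '' {i}ᶜ), ε < dist z (q i) := by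
    intro i
    have hnot : q i ∈ (convexHull ℝ (q '' {i}ᶜ))ᶜ := fun h => hq _ _ h rfl
    obtain ⟨δ, hδ, hsub⟩ := Metric.isOpen_iff.1 (hcomp {i}ᶜ).isClosed.isOpen_compl _ hnot
    refine ⟨δ / 2, by positivity, fun z hz => ?_⟩
    by_contra hle
    exact hsub (mem_ball.2 (by linarith)) hz
  choose ε hε hdist using hdist
  obtain ⟨δ, hδ, hδε⟩ : ∃ δ > 0, ∀ i, δ ≤ ε i :=
    ⟨Finset.univ.inf' Finset.univ_nonempty ε, (Finset.lt_inf'_iff _).2 fun i _ => hε i,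
      fun i => Finset.inf'_le _ (Finset.mem_univ i)⟩
  refine ⟨δ, hδ, ?_⟩
  have hclosed : IsClosed (convexHull ℝ (Set.range q)) := by
    rw [← Set.image_univ]
    exact (hcomp _).isClosed
  refine card_mul_volume_le_two_mul_sum hclosed q 3 ?_
  have hgen : ∀ᵐ v : Plane, ∀ i j, i ≠ j → crossLeft v (q i - q j) ≠ 0 := by
    rw [ae_all_iff]
    intro i
    rw [ae_all_iff]
    intro j
    by_cases hij : i = j
    · simp [hij]
    · have h := volume_crossLeft_eq_zero (sub_ne_zero.2 (hq.injective.ne hij))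
      have h' : ∀ᵐ v : Plane, ¬ crossLeft v (q i - q j) = 0 := by
        rw [ae_iff]
        simpa using h
      filter_upwards [h'] with v hv _ using hv
  filter_upwards [hgen] with v hv hvB
  have hv0 : v ≠ 0 := by
    rintro rfl
    exact hv 0 1 (by decide) (by simp [crossLeft_apply])
  have hinj : ∀ i j, i ≠ j → crossLeft v (q i) ≠ crossLeft v (q j) := fun i j hij h =>
    hv i j hij (by rw [map_sub, h, sub_self])
  obtain ⟨a, ha⟩ := Finite.exists_min fun i => crossLeft v (q i)
  obtain ⟨b, hb⟩ := Finite.exists_max fun i => crossLeft v (q i)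
  have hsub : ({a, b}ᶜ : Set (Fin 5)) ⊆ {i | q i + v ∈ convexHull ℝ (Set.range q)} ∪
      {i | q i - v ∈ convexHull ℝ (Set.range q)} := by
    intro i hi
    simp only [Set.mem_compl_iff, Set.mem_insert_iff, Set.mem_singleton_iff, not_or] at hi
    refine add_mem_or_sub_mem_convexHull (a := a) (b := b) hv0 (fun z hz => ?_)
      (lt_of_le_of_ne (ha i) (hinj _ _ (Ne.symm hi.1)))
      (lt_of_le_of_ne (hb i) (hinj _ _ hi.2))
    exact ((mem_closedBall_zero_iff.1 hvB).trans (hδε i)).trans_lt (hdist i z hz)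
  have h1 := (Set.ncard_le_ncard hsub (Set.toFinite _)).trans (Set.ncard_union_le _ _)
  have h2 : ({a, b} : Set (Fin 5)).ncard ≤ 2 :=
    (Set.ncard_insert_le a {b}).trans (by simp)
  have h3 := Set.ncard_add_ncard_compl ({a, b} : Set (Fin 5)) (Set.toFinite _) (Set.toFinite _)
  rw [Nat.card_eq_fintype_card, Fintype.card_fin] at h3
  omega

/-- Around a point that is not extreme, a convex set with nonempty interior covers at least half
of every small disk. -/
lemma exists_half_volume_le_of_notMem_extremePoints {t : Set Plane} (ht : Convex ℝ t)
    (hclosed : IsClosed t) (hint : (interior t).Nonempty) {x : Plane} (hx : x ∈ t)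
    (hext : x ∉ t.extremePoints ℝ) :
    ∃ ε > 0, volume.real (closedBall x ε) ≤ 2 * volume.real (t ∩ closedBall x ε) := by
  obtain ⟨e, he0, hep, hem⟩ : ∃ e : Plane, e ≠ 0 ∧ x + e ∈ t ∧ x - e ∈ t := by
    rw [mem_extremePoints_iff_left] at hext
    push Not at hext
    obtain ⟨a, ha, b, hb, ⟨s, s', hs, hs', hss, hsx⟩, hax⟩ := hext hx
    have h1 : x = a + s' • (b - a) := by
      rw [← hsx, show s = 1 - s' by linarith]
      module
    have hba : b - a ≠ 0 := by
      intro h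
      rw [h, smul_zero, add_zero] at h1
      exact hax h1.symm
    refine ⟨(s * s') • (b - a), smul_ne_zero (by positivity) hba, ?_, ?_⟩
    · have h2 : x + (s * s') • (b - a) = a + (s' + s * s') • (b - a) := by
        rw [h1]; module
      rw [h2]
      exact ht.add_smul_sub_mem ha hb ⟨by positivity, by nlinarith⟩
    · have h2 : x - (s * s') • (b - a) = a + (s' - s * s') • (b - a) := by
        rw [h1]; module
      rw [h2]
      exact ht.add_smul_sub_mem ha hb ⟨by nlinarith, by nlinarith⟩
  obtain ⟨g, hg, hcr⟩ : ∃ g : Plane, x + g ∈ t ∧ crossLeft g e ≠ 0 := by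
    by_contra hcon
    push Not at hcon
    have hsub : t ⊆ (fun y => -x + y) ⁻¹' {v : Plane | crossLeft v e = 0} := by
      intro y hy
      exact hcon (-x + y) (by simpa using hy)
    have h0 : volume t = 0 := by
      refine measure_mono_null hsub ?_
      rw [measure_preimage_add]
      exact volume_crossLeft_eq_zero he0
    exact (isOpen_interior.measure_pos volume hint).ne'
      (measure_mono_null interior_subset h0)
  set D := crossLeft g e with hD
  have hD0 : 0 < |D| := abs_pos.2 hcr
  set M := 4 * (‖g‖ + ‖e‖ + 1) with hM
  have hMpos : 0 < M := by positivity
  have hcross : ∀ v w : Plane, |crossLeft v w| ≤ 2 * (‖w‖ * ‖v‖) := by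
    intro v w
    have h := fun (y : Plane) (i : Fin 2) => PiLp.norm_apply_le y i
    simp only [Real.norm_eq_abs] at h
    rw [crossLeft_apply]
    calc |w 0 * v 1 - w 1 * v 0| ≤ |w 0| * |v 1| + |w 1| * |v 0| := by
          rw [← abs_mul, ← abs_mul]; exact abs_sub _ _
      _ ≤ ‖w‖ * ‖v‖ + ‖w‖ * ‖v‖ := by gcongr <;> exact h _ _
      _ = _ := by ring
  refine ⟨|D| / M, by positivity, ?_⟩
  have key : ∀ v : Plane, v ∈ closedBall (0 : Plane) (|D| / M) → x + v ∈ t ∨ x - v ∈ t := by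
    intro v hv
    rw [mem_closedBall_zero_iff, le_div_iff₀ hMpos] at hv
    have hdec : v = (crossLeft g v / D) • e + (crossLeft v e / D) • g := by
      have hDx : D = e 0 * g 1 - e 1 * g 0 := rfl
      ext i
      simp only [PiLp.add_apply, PiLp.smul_apply, smul_eq_mul, crossLeft_apply]
      field_simp
      rw [hDx]
      fin_cases i <;> simp <;> ring
    set α := crossLeft g v / D with hα
    set β := crossLeft v e / D with hβ
    have hα1 : |α| ≤ 1 / 2 := by
      rw [hα, abs_div, div_le_iff₀ hD0]
      have := hcross g v
      nlinarith [norm_nonneg v, norm_nonneg g, norm_nonneg e,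
        mul_nonneg (norm_nonneg v) (norm_nonneg e)]
    have hβ1 : |β| ≤ 1 / 2 := by
      rw [hβ, abs_div, div_le_iff₀ hD0]
      have := hcross v e
      nlinarith [norm_nonneg v, norm_nonneg g, norm_nonneg e,
        mul_nonneg (norm_nonneg v) (norm_nonneg g)]
    have hmem : ∀ a b : ℝ, |a| ≤ 1 / 2 → 0 ≤ b → b ≤ 1 / 2 → x + (a • e + b • g) ∈ t := by
      intro a b ha hb0 hb1
      rw [abs_le] at ha
      have h1 : x + (2 * a) • e ∈ t := by
        have h := ht hep hem (a := 1 / 2 + a) (b := 1 / 2 - a) (by linarith) (by linarith) (by ring)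
        convert h using 1
        module
      have h2 : x + (2 * b) • g ∈ t := by
        have h := ht hx hg (a := 1 - 2 * b) (b := 2 * b) (by linarith) (by linarith) (by ring)
        convert h using 1
        module
      have h := ht h1 h2 (a := 1 / 2) (b := 1 / 2) (by norm_num) (by norm_num) (by norm_num)
      convert h using 1
      module
    rw [abs_le] at hβ1
    rcases le_total 0 β with h | h
    · left
      rw [hdec]
      exact hmem α β hα1 h hβ1.2
    · right
      have h' := hmem (-α) (-β) (by rwa [abs_neg]) (by linarith) (by linarith)
      rw [hdec]
      convert h' using 1
      module
  have h := card_mul_volume_le_two_mul_sum hclosed (fun _ : Unit => x) 1 (ε := |D| / M)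
    (ae_of_all _ fun v hv => ?_)
  · rw [Measure.addHaar_real_closedBall_center volume x]
    simpa using h
  · rcases key v hv with h | h <;> simp [h]

/-- A set with five marked corners and lower bounds `dens` for its local densities, such that the
densities at the corners add up to at least `3 / 2`. -/
structure IsPentagonTile (t : Set Plane) (corners : Finset Plane) (dens : Plane → ℝ) : Prop where
  convex : Convex ℝ t
  card_corners : corners.card = 5
  corners_subset : ∀ x ∈ corners, x ∈ t
  exists_line : ∀ x ∈ corners, ∃ w : Plane, w ≠ 0 ∧ ∀ c : ℝ, c ≠ 0 → x + c • w ∉ t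
  dens_nonneg : ∀ x, 0 ≤ dens x
  dens_eq_half : ∀ x ∉ corners, dens x = 1 / 2
  dens_sum : 3 / 2 ≤ ∑ x ∈ corners, dens x
  dens_le : ∀ x ∈ t, ∃ ε₀ > 0, ∀ ε, 0 < ε → ε ≤ ε₀ →
    dens x * volume.real (closedBall x ε) ≤ volume.real (t ∩ closedBall x ε)

lemma volumeReal_closedBall_pos (x : Plane) {r : ℝ} (hr : 0 < r) :
    0 < volume.real (closedBall x r) := by
  rw [volumeReal_closedBall x hr.le]
  exact mul_pos (by positivity) volumeReal_unitBall_pos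

lemma dens_le_of_le {t : Set Plane} (ht : Convex ℝ t) {x : Plane} (hx : x ∈ t) {a ε ε₀ : ℝ}
    (hε : 0 < ε) (hle : ε ≤ ε₀)
    (h : a * volume.real (closedBall x ε₀) ≤ volume.real (t ∩ closedBall x ε₀)) :
    a * volume.real (closedBall x ε) ≤ volume.real (t ∩ closedBall x ε) := by
  have hε₀ : 0 < ε₀ := hε.trans_le hle
  refine le_trans ?_ (sq_mul_volume_inter_closedBall_le ht hx hε hle)
  have h' := mul_le_mul_of_nonneg_left h (sq_nonneg (ε / ε₀))
  refine le_trans (le_of_eq ?_) h'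
  rw [volumeReal_closedBall x hε.le, volumeReal_closedBall x hε₀.le]
  field_simp

/-- An extreme point of a polygon lies on a line meeting the polygon only at that point. -/
lemma exists_line_inter_convexHull_subset {ι : Type*} [Finite ι] {q : ι → Plane}
    (hq : ConvexIndependent ℝ q) (i : ι) :
    ∃ w : Plane, w ≠ 0 ∧ ∀ c : ℝ, c ≠ 0 → q i + c • w ∉ convexHull ℝ (Set.range q) := by
  have hcomp : IsCompact (convexHull ℝ (q '' {i}ᶜ)) :=
    (({i}ᶜ : Set ι).toFinite.image q).isCompact_convexHull (𝕜 := ℝ)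
  have hnot : q i ∉ convexHull ℝ (q '' {i}ᶜ) := fun h => hq _ _ h rfl
  obtain ⟨f, a, hfa, hfb⟩ :=
    geometric_hahn_banach_point_closed (convex_convexHull ℝ _) hcomp.isClosed hnot
  obtain ⟨w, hw, hw0⟩ : ∃ w ∈ LinearMap.ker (f : Plane →ₗ[ℝ] ℝ), w ≠ 0 := by
    apply Submodule.exists_mem_ne_zero_of_ne_bot
    intro hbot
    have h := LinearMap.finrank_le_finrank_of_injective (LinearMap.ker_eq_bot.1 hbot)
    simp at h
  refine ⟨w, hw0, fun c hc hmem => ?_⟩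
  have hrange : Set.range q = insert (q i) (q '' {i}ᶜ) := by
    rw [← Set.image_univ, ← Set.image_insert_eq, ← Set.union_compl_self {i}]
    rfl
  have hfw : f (q i + c • w) = f (q i) := by
    have : f w = 0 := hw
    simp [this]
  rw [hrange] at hmem
  rcases (q '' {i}ᶜ).eq_empty_or_nonempty with he | hne
  · rw [he] at hmem
    simp [hc, hw0] at hmem
  · rw [convexHull_insert hne] at hmem
    obtain ⟨y, hy, z, hz, hmem⟩ := mem_convexJoin.1 hmem
    rw [Set.mem_singleton_iff] at hy
    subst hy
    obtain ⟨s, s', hs, hs', hss, hsx⟩ := hmem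
    have hfz := hfb z hz
    have h1 : f (q i + c • w) = s * f (q i) + s' * f z := by
      rw [← hsx]; simp
    have h2 : s' * (f z - f (q i)) = 0 := by
      have : s = 1 - s' := by linarith
      rw [hfw, this] at h1
      linarith
    have h3 : s' = 0 := (mul_eq_zero.1 h2).resolve_right (by linarith)
    have h4 : s = 1 := by linarith
    rw [h3, h4] at hsx
    simp [hc, hw0] at hsx

lemma exists_isPentagonTile {q : Fin 5 → Plane} (hq : ConvexIndependent ℝ q)
    (hint : (interior (convexHull ℝ (Set.range q))).Nonempty) :
    ∃ corners dens, IsPentagonTile (convexHull ℝ (Set.range q)) corners dens := by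
  classical
  obtain ⟨ε₀, hε₀, hsum⟩ := exists_three_mul_volume_le_corners hq
  set t := convexHull ℝ (Set.range q) with ht
  have hconv : Convex ℝ t := convex_convexHull ℝ _
  have hclosed : IsClosed t :=
    ((Set.finite_range q).isCompact_convexHull (𝕜 := ℝ)).isClosed
  have hB := volumeReal_closedBall_pos 0 hε₀
  refine ⟨Finset.univ.image q, fun x => if x ∈ Finset.univ.image q then
    volume.real (t ∩ closedBall x ε₀) / volume.real (closedBall (0 : Plane) ε₀) else 1 / 2,
    hconv, ?_, ?_, ?_, ?_, ?_, ?_, ?_⟩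
  · rw [Finset.card_image_of_injective _ hq.injective]
    simp
  · simp only [Finset.mem_image, Finset.mem_univ, true_and]
    rintro _ ⟨i, rfl⟩
    exact subset_convexHull ℝ _ ⟨i, rfl⟩
  · simp only [Finset.mem_image, Finset.mem_univ, true_and]
    rintro _ ⟨i, rfl⟩
    exact exists_line_inter_convexHull_subset hq i
  · intro x
    split_ifs <;> positivity
  · intro x hx
    simp only [hx, if_false]
  · rw [Finset.sum_image hq.injective.injOn]
    simp only [Finset.mem_image_of_mem q (Finset.mem_univ _), if_true]
    rw [← Finset.sum_div, le_div_iff₀ hB]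
    linarith
  · intro x hx
    by_cases hxK : x ∈ Finset.univ.image q
    · refine ⟨ε₀, hε₀, fun ε hε hle => dens_le_of_le hconv hx hε hle ?_⟩
      rw [if_pos hxK, Measure.addHaar_real_closedBall_center volume x, div_mul_cancel₀ _ hB.ne']
    · have hext : x ∉ t.extremePoints ℝ := by
        intro h
        apply hxK
        simpa using extremePoints_convexHull_subset h
      obtain ⟨ε₁, hε₁, h⟩ :=
        exists_half_volume_le_of_notMem_extremePoints hconv hclosed hint hx hext
      refine ⟨ε₁, hε₁, fun ε hε hle => dens_le_of_le hconv hx hε hle ?_⟩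
      rw [if_neg hxK]
      linarith

lemma ConvexIndependent.comp_isometryEquiv {ι : Type*} {p : ι → Plane}
    (hp : ConvexIndependent ℝ p) (f : Plane ≃ᵢ Plane) : ConvexIndependent ℝ (f ∘ p) := by
  intro s x hx
  rw [Set.image_comp, ← f.coeFn_toRealAffineIsometryEquiv] at hx
  have h := AffineMap.image_convexHull
    (f.toRealAffineIsometryEquiv.toAffineEquiv : Plane →ᵃ[ℝ] Plane) (p '' s)
  change f.toRealAffineIsometryEquiv '' _ = convexHull ℝ (f.toRealAffineIsometryEquiv '' _) at h
  rw [← h] at hx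
  obtain ⟨y, hy, hyx⟩ := hx
  exact hp s x (f.toRealAffineIsometryEquiv.injective hyx ▸ hy)

lemma image_convexHull_isometryEquiv (f : Plane ≃ᵢ Plane) (s : Set Plane) :
    f '' convexHull ℝ s = convexHull ℝ (f '' s) := by
  have h := AffineMap.image_convexHull
    (f.toRealAffineIsometryEquiv.toAffineEquiv : Plane →ᵃ[ℝ] Plane) s
  change f.toRealAffineIsometryEquiv '' _ = convexHull ℝ (f.toRealAffineIsometryEquiv '' _) at h
  simpa using h

/-- Marked corners and density bounds for all tiles of a tiling, together with uniform bounds for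
the size of the tiles. -/
structure PentagonSystem (T : PlaneTiling) where
  corners : Set Plane → Finset Plane
  dens : Set Plane → Plane → ℝ
  u : ℝ
  U : ℝ
  u_pos : 0 < u
  U_pos : 0 < U
  exists_ball_subset : ∀ t ∈ T.tiles, ∃ c, closedBall c u ⊆ t
  dist_le : ∀ t ∈ T.tiles, ∀ x ∈ t, ∀ y ∈ t, dist x y ≤ U
  isPentagonTile : ∀ t ∈ T.tiles, IsPentagonTile t (corners t) (dens t)

lemma nonempty_pentagonSystem {p : Fin 5 → Plane} (hp : ConvexIndependent ℝ p) {T : PlaneTiling}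
    (hmono : IsMonohedralBy T (convexHull ℝ (Set.range p))) (hnorm : IsNormal T) :
    Nonempty (PentagonSystem T) := by
  obtain ⟨-, -, u, U, hu, huU, hball⟩ := hnorm
  have h : ∀ t, ∃ corners dens, t ∈ T.tiles → IsPentagonTile t corners dens := by
    intro t
    by_cases ht : t ∈ T.tiles
    · obtain ⟨f, hf⟩ := hmono t ht
      rw [image_convexHull_isometryEquiv, ← Set.range_comp] at hf
      obtain ⟨c, hc⟩ := (hball t ht).1
      obtain ⟨corners, dens, h⟩ := exists_isPentagonTile (hp.comp_isometryEquiv f) (by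
        rw [← hf]
        exact ⟨c, interior_mono hc (ball_subset_interior_closedBall (mem_ball_self hu))⟩)
      exact ⟨corners, dens, fun _ => hf ▸ h⟩
    · exact ⟨∅, 0, fun h => absurd h ht⟩
  choose corners dens h using h
  refine ⟨⟨corners, dens, u, 2 * U, hu, by linarith, fun t ht => (hball t ht).1, ?_, h⟩⟩
  intro t ht x hx y hy
  obtain ⟨c, hc⟩ := (hball t ht).2
  have h1 := mem_closedBall.1 (hc hx)
  have h2 := mem_closedBall'.1 (hc hy)
  linarith [dist_triangle x c y]

namespace PentagonSystem

variable {T : PlaneTiling}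

lemma interior_nonempty (S : PentagonSystem T) {t : Set Plane} (ht : t ∈ T.tiles) :
    (interior t).Nonempty := by
  obtain ⟨c, hc⟩ := S.exists_ball_subset t ht
  exact ⟨c, interior_mono hc (ball_subset_interior_closedBall (mem_ball_self S.u_pos))⟩

lemma subset_closedBall (S : PentagonSystem T) {t : Set Plane} (ht : t ∈ T.tiles) {x : Plane}
    (hx : x ∈ t) : t ⊆ closedBall x S.U :=
  fun y hy => mem_closedBall.2 (S.dist_le t ht y hy x hx)

lemma aedisjoint (S : PentagonSystem T) {t₁ t₂ : Set Plane} (h₁ : t₁ ∈ T.tiles)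
    (h₂ : t₂ ∈ T.tiles) (hne : t₁ ≠ t₂) : AEDisjoint volume t₁ t₂ := by
  have hsub : t₁ ∩ t₂ ⊆ frontier t₁ ∪ frontier t₂ := by
    rintro x ⟨hx₁, hx₂⟩
    rw [(T.closed t₁ h₁).frontier_eq, (T.closed t₂ h₂).frontier_eq]
    by_contra hcon
    simp only [Set.mem_union, Set.mem_sdiff, hx₁, hx₂, true_and, not_or, not_not] at hcon
    have h : x ∈ interior t₁ ∩ interior t₂ := hcon
    rw [T.interiors_disjoint t₁ h₁ t₂ h₂ hne] at h
    exact h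
  refine measure_mono_null hsub (measure_union_null ?_ ?_)
  · exact (S.isPentagonTile t₁ h₁).convex.addHaar_frontier volume
  · exact (S.isPentagonTile t₂ h₂).convex.addHaar_frontier volume

lemma sum_volume_inter_le (S : PentagonSystem T) {s : Finset (Set Plane)}
    (hs : ∀ t ∈ s, t ∈ T.tiles) {A : Set Plane} (hA : IsClosed A) (hfin : volume A ≠ ⊤) :
    ∑ t ∈ s, volume.real (t ∩ A) ≤ volume.real A := by
  rw [← measureReal_biUnion_finset₀]
  · exact measureReal_mono (Set.iUnion₂_subset fun t _ => Set.inter_subset_right) hfin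
  · intro t₁ h₁ t₂ h₂ hne
    exact (S.aedisjoint (hs _ h₁) (hs _ h₂) hne).mono Set.inter_subset_left Set.inter_subset_left
  · exact fun t ht => ((T.closed t (hs t ht)).inter hA).measurableSet.nullMeasurableSet

lemma card_mul_le_of_subset (S : PentagonSystem T) {s : Finset (Set Plane)}
    (hs : ∀ t ∈ s, t ∈ T.tiles) {A : Set Plane} (hfin : volume A ≠ ⊤) (hsub : ∀ t ∈ s, t ⊆ A) :
    s.card * (S.u ^ 2 * volume.real (ball (0 : Plane) 1)) ≤ volume.real A := by
  have h1 : ∑ t ∈ s, volume.real t ≤ volume.real A := by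
    have h := measureReal_biUnion_finset₀ (μ := volume) (s := s) (f := fun t => t)
      (fun t₁ h₁ t₂ h₂ hne => S.aedisjoint (hs _ h₁) (hs _ h₂) hne)
      (fun t ht => (T.closed t (hs t ht)).measurableSet.nullMeasurableSet)
      (fun t ht => measure_ne_top_of_subset (hsub t ht) hfin)
    rw [← h]
    exact measureReal_mono (Set.iUnion₂_subset hsub) hfin
  refine le_trans ?_ h1
  rw [← nsmul_eq_mul]
  refine Finset.card_nsmul_le_sum _ _ _ fun t ht => ?_
  obtain ⟨c, hc⟩ := S.exists_ball_subset t (hs t ht)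
  rw [← volumeReal_closedBall c S.u_pos.le]
  exact measureReal_mono hc (measure_ne_top_of_subset (hsub t ht) hfin)

lemma finite_of_subset (S : PentagonSystem T) {s : Set (Set Plane)} (hs : s ⊆ T.tiles)
    {A : Set Plane} (hfin : volume A ≠ ⊤) (hsub : ∀ t ∈ s, t ⊆ A) : s.Finite := by
  by_contra hinf
  have hc : 0 < S.u ^ 2 * volume.real (ball (0 : Plane) 1) :=
    mul_pos (pow_pos S.u_pos 2) volumeReal_unitBall_pos
  obtain ⟨n, hn⟩ := exists_nat_gt (volume.real A / (S.u ^ 2 * volume.real (ball (0 : Plane) 1)))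
  obtain ⟨F, hF, hcard⟩ := Set.Infinite.exists_subset_card_eq hinf n
  have h := S.card_mul_le_of_subset (fun t ht => hs (hF ht)) hfin fun t ht => hsub t (hF ht)
  rw [hcard] at h
  rw [div_lt_iff₀ hc] at hn
  linarith

lemma finite_meeting (S : PentagonSystem T) (x : Plane) (R : ℝ) :
    {t | t ∈ T.tiles ∧ (t ∩ closedBall x R).Nonempty}.Finite := by
  refine S.finite_of_subset (fun t ht => ht.1) (A := closedBall x (R + S.U))
    measure_closedBall_lt_top.ne ?_
  rintro t ⟨ht, y, hyt, hy⟩ z hz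
  have h1 := S.dist_le t ht z hz y hyt
  have h2 := mem_closedBall.1 hy
  exact mem_closedBall.2 (by linarith [dist_triangle z y x])

lemma finite_tilesAt (S : PentagonSystem T) (x : Plane) :
    {t | t ∈ T.tiles ∧ x ∈ t}.Finite :=
  (S.finite_meeting x 0).subset fun _ ht => ⟨ht.1, x, ht.2, by simp⟩

/-- The finite set of tiles containing a point. -/
def tilesAt (S : PentagonSystem T) (x : Plane) : Finset (Set Plane) :=
  (S.finite_tilesAt x).toFinset

lemma mem_tilesAt (S : PentagonSystem T) {x : Plane} {t : Set Plane} :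
    t ∈ S.tilesAt x ↔ t ∈ T.tiles ∧ x ∈ t := by
  simp [tilesAt]

lemma valence_eq_card (S : PentagonSystem T) (x : Plane) : valence T x = (S.tilesAt x).card :=
  Set.ncard_eq_toFinset_card _ (S.finite_tilesAt x)

lemma valence_mul_le (S : PentagonSystem T) (x : Plane) :
    valence T x * S.u ^ 2 ≤ S.U ^ 2 := by
  have h := S.card_mul_le_of_subset (s := S.tilesAt x) (fun t ht => (S.mem_tilesAt.1 ht).1)
    (measure_closedBall_lt_top (x := x) (r := S.U)).ne
    (fun t ht => S.subset_closedBall (S.mem_tilesAt.1 ht).1 (S.mem_tilesAt.1 ht).2)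
  rw [volumeReal_closedBall x S.U_pos.le, ← mul_assoc, ← S.valence_eq_card] at h
  exact le_of_mul_le_mul_right h volumeReal_unitBall_pos

lemma sum_dens_le_one (S : PentagonSystem T) (x : Plane) :
    ∑ t ∈ S.tilesAt x, S.dens t x ≤ 1 := by
  have hloc : ∀ t ∈ S.tilesAt x, ∀ᶠ ε in nhdsWithin (0 : ℝ) (Set.Ioi 0),
      S.dens t x * volume.real (closedBall x ε) ≤ volume.real (t ∩ closedBall x ε) := by
    intro t ht
    obtain ⟨ht, hx⟩ := S.mem_tilesAt.1 ht
    obtain ⟨ε₀, hε₀, h⟩ := (S.isPentagonTile t ht).dens_le x hx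
    filter_upwards [Ioc_mem_nhdsGT hε₀] with ε hε using h ε hε.1 hε.2
  obtain ⟨ε, hε, hpos⟩ :=
    (((Finset.eventually_all _).2 hloc).and self_mem_nhdsWithin).exists
  have hB := volumeReal_closedBall_pos x (Set.mem_Ioi.1 hpos)
  have h1 := Finset.sum_le_sum hε
  rw [← Finset.sum_mul] at h1
  have h2 := S.sum_volume_inter_le (s := S.tilesAt x) (fun t ht => (S.mem_tilesAt.1 ht).1)
    isClosed_closedBall (measure_closedBall_lt_top (x := x) (r := ε)).ne
  exact le_of_mul_le_mul_right (by linarith) hB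

lemma exists_ball_forall_mem (S : PentagonSystem T) (x : Plane) :
    ∃ ε > 0, ∀ t ∈ T.tiles, ∀ y ∈ t, y ∈ ball x ε → x ∈ t := by
  set F : Set (Set Plane) := {t | t ∈ T.tiles ∧ (t ∩ closedBall x 1).Nonempty ∧ x ∉ t} with hF
  have hfin : F.Finite := (S.finite_meeting x 1).subset fun t ht => ⟨ht.1, ht.2.1⟩
  have hclosed : IsClosed (⋃₀ F) := by
    rw [Set.sUnion_eq_biUnion]
    exact hfin.isClosed_biUnion fun t ht => T.closed t ht.1
  have hx : x ∈ (⋃₀ F)ᶜ := by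
    rintro ⟨t, ht, hxt⟩
    exact ht.2.2 hxt
  obtain ⟨ε, hε, hsub⟩ := Metric.isOpen_iff.1 hclosed.isOpen_compl x hx
  refine ⟨min ε 1, by positivity, fun t ht y hy hyb => ?_⟩
  by_contra hxt
  have h1 : y ∈ ball x ε := ball_subset_ball (min_le_left _ _) hyb
  have h2 : y ∈ closedBall x 1 := ball_subset_closedBall (ball_subset_ball (min_le_right _ _) hyb)
  exact hsub h1 ⟨t, ⟨ht, ⟨y, hy, h2⟩, hxt⟩, hy⟩

lemma isTilingVertex_of_mem_corners (S : PentagonSystem T) {t : Set Plane} (ht : t ∈ T.tiles)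
    {x : Plane} (hx : x ∈ S.corners t) : IsTilingVertex T x := by
  have htile := S.isPentagonTile t ht
  have hxt : x ∈ t := htile.corners_subset x hx
  obtain ⟨w, hw0, hw⟩ := htile.exists_line x hx
  obtain ⟨ε, hε, hball⟩ := S.exists_ball_forall_mem x
  by_contra hval
  rw [IsTilingVertex, S.valence_eq_card] at hval
  have hother : ∀ y ∈ ball x ε, y ∉ t → ∃ s ∈ S.tilesAt x, s ≠ t ∧ y ∈ s := by
    intro y hy hyt
    obtain ⟨s, hs, hys⟩ : y ∈ ⋃₀ T.tiles := T.covers ▸ Set.mem_univ y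
    exact ⟨s, S.mem_tilesAt.2 ⟨hs, hball s hs y hys hy⟩, fun h => hyt (h ▸ hys), hys⟩
  have hunique : ∀ s₁ ∈ S.tilesAt x, ∀ s₂ ∈ S.tilesAt x, s₁ ≠ t → s₂ ≠ t → s₁ = s₂ := by
    classical
    intro s₁ h₁ s₂ h₂ hn₁ hn₂
    by_contra hne
    apply hval
    have hsub : ({t, s₁, s₂} : Finset (Set Plane)) ⊆ S.tilesAt x := by
      intro s hs
      simp only [Finset.mem_insert, Finset.mem_singleton] at hs
      rcases hs with rfl | rfl | rfl
      exacts [S.mem_tilesAt.2 ⟨ht, hxt⟩, h₁, h₂]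
    have h := Finset.card_le_card hsub
    rwa [Finset.card_eq_three.2 ⟨t, s₁, s₂, hn₁.symm, hn₂.symm, hne, rfl⟩] at h
  have hwn : 0 < ‖w‖ := norm_pos_iff.2 hw0
  set c : ℝ := ε / (2 * ‖w‖) with hc
  have hcpos : 0 < c := by positivity
  have hcw : ∀ d : ℝ, |d| = c → x + d • w ∈ ball x ε ∩ tᶜ := by
    intro d hd
    refine ⟨?_, hw d fun h => ?_⟩
    · rw [mem_ball, dist_eq_norm, add_sub_cancel_left, norm_smul, Real.norm_eq_abs, hd, hc]
      field_simp
      linarith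
    · rw [h, abs_zero] at hd
      linarith
  have hopen : IsOpen (ball x ε ∩ tᶜ) := isOpen_ball.inter (T.closed t ht).isOpen_compl
  obtain ⟨ρ₁, hρ₁, hb₁⟩ := Metric.isOpen_iff.1 hopen _ (hcw c (abs_of_pos hcpos))
  obtain ⟨ρ₂, hρ₂, hb₂⟩ := Metric.isOpen_iff.1 hopen _
    (hcw (-c) (by rw [abs_neg, abs_of_pos hcpos]))
  obtain ⟨s, hs, hst, -⟩ := hother _ (hcw c (abs_of_pos hcpos)).1 (hcw c (abs_of_pos hcpos)).2
  have hmem : ∀ y ∈ ball x ε ∩ tᶜ, y ∈ s := by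
    intro y hy
    obtain ⟨s', hs', hne, hys'⟩ := hother y hy.1 hy.2
    rwa [hunique s hs s' hs' hst hne]
  have hsT := (S.mem_tilesAt.1 hs).1
  have hsub : ball x (min ρ₁ ρ₂) ⊆ s := by
    intro z hz
    have h1 : z + c • w ∈ s := by
      apply hmem _ (hb₁ _)
      rw [mem_ball, dist_add_right]
      exact (mem_ball.1 hz).trans_le (min_le_left _ _)
    have h2 : z + (-c) • w ∈ s := by
      apply hmem _ (hb₂ _)
      rw [mem_ball, dist_add_right]
      exact (mem_ball.1 hz).trans_le (min_le_right _ _)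
    have h := (S.isPentagonTile s hsT).convex h1 h2 (a := 1 / 2) (b := 1 / 2)
      (by norm_num) (by norm_num) (by norm_num)
    convert h using 1
    module
  have hxs : x ∈ interior s :=
    interior_maximal hsub isOpen_ball (mem_ball_self (lt_min hρ₁ hρ₂))
  have hcl : x ∈ closure (interior t) := by
    rw [htile.convex.closure_interior_eq_closure_of_nonempty_interior (S.interior_nonempty ht)]
    exact subset_closure hxt
  obtain ⟨y, hy⟩ := mem_closure_iff.1 hcl _ isOpen_interior hxs
  rw [T.interiors_disjoint s hsT t ht hst] at hy
  exact hy

lemma exists_mem_corners (S : PentagonSystem T) {x : Plane} (hx : IsTilingVertex T x) :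
    ∃ t ∈ S.tilesAt x, x ∈ S.corners t := by
  by_contra hcon
  push Not at hcon
  have h1 : ∑ t ∈ S.tilesAt x, S.dens t x = ∑ t ∈ S.tilesAt x, (1 / 2 : ℝ) :=
    Finset.sum_congr rfl fun t ht =>
      (S.isPentagonTile t (S.mem_tilesAt.1 ht).1).dens_eq_half x (hcon t ht)
  have h2 := S.sum_dens_le_one x
  rw [h1, Finset.sum_const, nsmul_eq_mul, ← S.valence_eq_card] at h2
  have h3 : (3 : ℝ) ≤ valence T x := by exact_mod_cast hx
  linarith

/-- The vertices in a set `A` are corners of the tiles meeting `A`. -/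
lemma vertices_subset (S : PentagonSystem T) {A : Set Plane} (F : Finset (Set Plane))
    (hF : ∀ t ∈ T.tiles, (t ∩ A).Nonempty → t ∈ F) :
    {x | IsTilingVertex T x ∧ x ∈ A} ⊆ ⋃ t ∈ F, (S.corners t : Set Plane) := by
  rintro x ⟨hx, hxA⟩
  obtain ⟨t, ht, hxt⟩ := S.exists_mem_corners hx
  obtain ⟨htT, hxt'⟩ := S.mem_tilesAt.1 ht
  exact Set.mem_biUnion (hF t htT ⟨x, hxt', hxA⟩) hxt

lemma finite_vertices (S : PentagonSystem T) (M : Plane) (R : ℝ) :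
    {x | IsTilingVertex T x ∧ x ∈ closedBall M R}.Finite := by
  refine Set.Finite.subset ?_ (S.vertices_subset (S.finite_meeting M R).toFinset ?_)
  · exact Set.Finite.biUnion (Finset.finite_toSet _) fun t _ => Finset.finite_toSet _
  · intro t ht hne
    simpa using ⟨ht, hne⟩

lemma subset_closedBall_of_mem_patch (S : PentagonSystem T) {r : ℝ} {M : Plane} {t : Set Plane}
    (ht : t ∈ patch T r M) : t ⊆ closedBall M (r + S.U) := by
  have hbd : ∀ s ∈ boundaryTiles T r M, s ⊆ closedBall M (r + S.U) := by
    rintro s ⟨hs, ⟨z, hzs, hz⟩, -⟩ y hy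
    have h1 := S.dist_le s hs y hy z hzs
    have h2 := mem_sphere.1 hz
    exact mem_closedBall.2 (by linarith [dist_triangle y z M])
  rcases ht with (⟨-, ht⟩ | ht) | ⟨-, -, x, -, hsub, hbounded⟩
  · exact ht.trans (closedBall_subset_closedBall (by linarith [S.U_pos]))
  · exact hbd t ht
  · intro y hy
    by_contra hfar
    have hyM : y - M ≠ 0 := by
      intro h
      rw [sub_eq_zero] at h
      apply hfar
      subst h
      rw [mem_closedBall, dist_self]
      by_contra hneg
      have hempty : ⋃₀ boundaryTiles T r y = ∅ := by
        rw [Set.sUnion_eq_empty]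
        intro s hs
        exact Set.subset_empty_iff.1
          ((hbd s hs).trans (closedBall_eq_empty.2 (not_le.1 hneg)).subset)
      rw [hempty, Set.compl_empty, connectedComponentIn_univ,
        PreconnectedSpace.connectedComponent_eq_univ] at hbounded
      exact NormedSpace.unbounded_univ ℝ Plane hbounded
    set ray : Set Plane := (fun c : ℝ => M + c • (y - M)) '' Set.Ici 1 with hray
    have hconn : IsPreconnected ray := isPreconnected_Ici.image _ (by fun_prop)
    have hyray : y ∈ ray := ⟨1, by simp, by simp⟩
    have hdist : ∀ c : ℝ, 1 ≤ c → dist (M + c • (y - M)) M = c * dist y M := by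
      intro c hc
      rw [dist_eq_norm, add_sub_cancel_left, norm_smul, Real.norm_of_nonneg (by linarith),
        dist_eq_norm]
    have hraysub : ray ⊆ (⋃₀ boundaryTiles T r M)ᶜ := by
      rintro _ ⟨c, hc, rfl⟩ ⟨s, hs, hzs⟩
      have h := mem_closedBall.1 (hbd s hs hzs)
      rw [hdist c hc] at h
      rw [mem_closedBall, not_le] at hfar
      nlinarith [dist_nonneg (x := y) (y := M), Set.mem_Ici.1 hc]
    have hsubset := hconn.subset_connectedComponentIn hyray hraysub
    rw [← connectedComponentIn_eq (hsub hy)] at hsubset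
    obtain ⟨R, hR⟩ := (isBounded_iff_subset_closedBall M).1 (hbounded.subset hsubset)
    have hpos : 0 < dist y M := dist_pos.2 (sub_ne_zero.1 hyM)
    have h := mem_closedBall.1 (hR ⟨max 1 (R / dist y M + 1), Set.mem_Ici.2 (le_max_left _ _), rfl⟩)
    dsimp only at h
    rw [hdist _ (le_max_left _ _), ← le_div_iff₀ hpos] at h
    linarith [le_max_right 1 (R / dist y M + 1)]

lemma mem_patch_of_mem_closedBall (S : PentagonSystem T) {r : ℝ} {M : Plane} {t : Set Plane}
    (ht : t ∈ T.tiles) {y : Plane} (hyt : y ∈ t) (hy : y ∈ closedBall M r) :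
    t ∈ patch T r M := by
  left
  by_cases hsub : t ⊆ closedBall M r
  · exact Or.inl ⟨ht, hsub⟩
  · right
    obtain ⟨z, hzt, hz⟩ := Set.not_subset.1 hsub
    rw [mem_closedBall, not_le] at hz
    obtain ⟨w, hwt, hw⟩ := (S.isPentagonTile t ht).convex.isPreconnected.intermediate_value hyt hzt
      (f := fun w => dist w M) (by fun_prop) ⟨mem_closedBall.1 hy, hz.le⟩
    exact ⟨ht, ⟨w, hwt, hw⟩, hsub⟩

lemma patch_subset_tiles {r : ℝ} {M : Plane} : patch T r M ⊆ T.tiles := by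
  rintro t ((ht | ht) | ht) <;> exact ht.1

lemma finite_patch (S : PentagonSystem T) (r : ℝ) (M : Plane) : (patch T r M).Finite :=
  S.finite_of_subset patch_subset_tiles (measure_closedBall_lt_top (x := M) (r := r + S.U)).ne
    fun _ ht => S.subset_closedBall_of_mem_patch ht

lemma sq_le_tCount_mul (S : PentagonSystem T) {r : ℝ} (hr : 0 ≤ r) (M : Plane) :
    r ^ 2 ≤ tCount T r M * S.U ^ 2 := by
  have hcover : closedBall M r ⊆ ⋃ t ∈ (S.finite_patch r M).toFinset, t := by
    intro y hy
    obtain ⟨t, ht, hyt⟩ : y ∈ ⋃₀ T.tiles := T.covers ▸ Set.mem_univ y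
    exact Set.mem_biUnion (by simpa using S.mem_patch_of_mem_closedBall ht hyt hy) hyt
  have hle : ∀ t ∈ (S.finite_patch r M).toFinset,
      volume.real t ≤ S.U ^ 2 * volume.real (ball (0 : Plane) 1) := by
    intro t ht
    have htT := patch_subset_tiles ((Set.Finite.mem_toFinset _).1 ht)
    obtain ⟨c, hc⟩ := S.interior_nonempty htT
    rw [← volumeReal_closedBall c S.U_pos.le]
    exact measureReal_mono (S.subset_closedBall htT (interior_subset hc))
      measure_closedBall_lt_top.ne
  have hfin : volume (⋃ t ∈ (S.finite_patch r M).toFinset, t) ≠ ⊤ := by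
    refine measure_ne_top_of_subset (Set.iUnion₂_subset fun t ht => ?_)
      (measure_closedBall_lt_top (x := M) (r := r + S.U)).ne
    exact S.subset_closedBall_of_mem_patch ((Set.Finite.mem_toFinset _).1 ht)
  have h1 := (measureReal_mono hcover hfin).trans (measureReal_biUnion_finset_le _ _)
  have h2 := Finset.sum_le_card_nsmul _ _ _ hle
  rw [← Set.ncard_eq_toFinset_card _ (S.finite_patch r M), nsmul_eq_mul, ← mul_assoc] at h2
  rw [volumeReal_closedBall M hr] at h1
  exact le_of_mul_le_mul_right (h1.trans h2) volumeReal_unitBall_pos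

lemma finite_patch_vertices (S : PentagonSystem T) (r : ℝ) (M : Plane) :
    {x | IsTilingVertex T x ∧ x ∈ ⋃₀ patch T r M}.Finite := by
  refine (S.finite_vertices M (r + S.U)).subset ?_
  rintro x ⟨hx, t, ht, hxt⟩
  exact ⟨hx, S.subset_closedBall_of_mem_patch ht hxt⟩

/-- The finite set of vertices of the patch. -/
def patchVertices (S : PentagonSystem T) (r : ℝ) (M : Plane) : Finset Plane :=
  (S.finite_patch_vertices r M).toFinset

lemma mem_patchVertices (S : PentagonSystem T) {r : ℝ} {M x : Plane} :
    x ∈ S.patchVertices r M ↔ IsTilingVertex T x ∧ x ∈ ⋃₀ patch T r M := by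
  simp [patchVertices]

lemma card_boundary_vertices_mul_le (S : PentagonSystem T) {r : ℝ} (hr : S.U ≤ r) (M : Plane) :
    ((S.patchVertices r M).filter fun x => r < dist x M).card * S.u ^ 2 ≤
      5 * ((r + 2 * S.U) ^ 2 - (r - S.U) ^ 2) := by
  classical
  have hU := S.U_pos
  set A := closedBall M (r + 2 * S.U) \ closedBall M (r - S.U) with hA
  have hAfin : volume A ≠ ⊤ := measure_ne_top_of_subset Set.sdiff_subset
    measure_closedBall_lt_top.ne
  have hF : {t | t ∈ T.tiles ∧ t ⊆ A}.Finite :=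
    S.finite_of_subset (fun t ht => ht.1) hAfin fun t ht => ht.2
  set F := hF.toFinset with hFdef
  have hsub : ((S.patchVertices r M).filter fun x => r < dist x M) ⊆ F.biUnion S.corners := by
    intro x hx
    obtain ⟨hx, hrx⟩ := Finset.mem_filter.1 hx
    obtain ⟨hvert, s, hs, hxs⟩ := S.mem_patchVertices.1 hx
    have hxM := mem_closedBall.1 (S.subset_closedBall_of_mem_patch hs hxs)
    obtain ⟨t, ht, hxt⟩ := S.exists_mem_corners hvert
    obtain ⟨htT, hxt'⟩ := S.mem_tilesAt.1 ht
    refine Finset.mem_biUnion.2 ⟨t, (Set.Finite.mem_toFinset _).2 ⟨htT, fun y hy => ?_⟩, hxt⟩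
    have hxy := S.dist_le t htT x hxt' y hy
    refine ⟨mem_closedBall.2 ?_, fun h => ?_⟩
    · linarith [dist_triangle_left y M x]
    · linarith [dist_triangle x y M, mem_closedBall.1 h]
  have h1 : ((S.patchVertices r M).filter fun x => r < dist x M).card ≤ F.card * 5 := by
    refine (Finset.card_le_card hsub).trans (Finset.card_biUnion_le_card_mul _ _ _ fun t ht => ?_)
    exact (S.isPentagonTile t ((Set.Finite.mem_toFinset _).1 ht).1).card_corners.le
  have h2 := S.card_mul_le_of_subset (s := F) (fun t ht => ((Set.Finite.mem_toFinset _).1 ht).1)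
    hAfin fun t ht => ((Set.Finite.mem_toFinset _).1 ht).2
  rw [hA, measureReal_sdiff (closedBall_subset_closedBall (by linarith))
    isClosed_closedBall.measurableSet measure_closedBall_lt_top.ne,
    volumeReal_closedBall M (by linarith), volumeReal_closedBall M (by linarith), ← sub_mul,
    ← mul_assoc] at h2
  have h3 := le_of_mul_le_mul_right h2 volumeReal_unitBall_pos
  have h4 : (((S.patchVertices r M).filter fun x => r < dist x M).card : ℝ) ≤ F.card * 5 := by
    exact_mod_cast h1
  nlinarith [pow_pos S.u_pos 2]

lemma corners_subset_patchVertices (S : PentagonSystem T) {r : ℝ} {M : Plane} {t : Set Plane}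
    (ht : t ∈ patch T r M) : ∀ x ∈ S.corners t, x ∈ S.patchVertices r M ∧ x ∈ t := by
  intro x hx
  have htT := patch_subset_tiles ht
  have hxt := (S.isPentagonTile t htT).corners_subset x hx
  exact ⟨S.mem_patchVertices.2 ⟨S.isTilingVertex_of_mem_corners htT hx, t, ht, hxt⟩, hxt⟩

open Classical in
lemma sum_patchVertices_comm (S : PentagonSystem T) (r : ℝ) (M : Plane)
    (g : Plane → Set Plane → ℝ) :
    ∑ x ∈ S.patchVertices r M, ∑ t ∈ (S.tilesAt x).filter (· ∈ patch T r M), g x t =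
      ∑ t ∈ (S.finite_patch r M).toFinset, ∑ x ∈ (S.patchVertices r M).filter (· ∈ t), g x t := by
  refine Finset.sum_comm' fun x t => ?_
  simp only [Finset.mem_filter, S.mem_tilesAt, Set.Finite.mem_toFinset]
  constructor
  · rintro ⟨hx, ⟨-, hxt⟩, ht⟩
    exact ⟨⟨hx, hxt⟩, ht⟩
  · rintro ⟨⟨hx, hxt⟩, ht⟩
    exact ⟨hx, ⟨patch_subset_tiles ht, hxt⟩, ht⟩

lemma five_mul_tCount_le (S : PentagonSystem T) (r : ℝ) (M : Plane) :
    5 * (tCount T r M : ℝ) ≤ ∑ x ∈ S.patchVertices r M, (valence T x : ℝ) := by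
  classical
  have h1 : ∑ x ∈ S.patchVertices r M, ∑ t ∈ (S.tilesAt x).filter (· ∈ patch T r M), (1 : ℝ) ≤
      ∑ x ∈ S.patchVertices r M, (valence T x : ℝ) := by
    refine Finset.sum_le_sum fun x _ => ?_
    rw [Finset.sum_const, nsmul_eq_mul, mul_one, S.valence_eq_card]
    exact_mod_cast Finset.card_filter_le _ _
  rw [S.sum_patchVertices_comm] at h1
  refine le_trans ?_ h1
  rw [tCount, Set.ncard_eq_toFinset_card _ (S.finite_patch r M), mul_comm, ← nsmul_eq_mul]
  refine Finset.card_nsmul_le_sum _ _ _ fun t ht => ?_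
  have ht := (Set.Finite.mem_toFinset _).1 ht
  have h2 : S.corners t ⊆ (S.patchVertices r M).filter (· ∈ t) := fun x hx =>
    Finset.mem_filter.2 (S.corners_subset_patchVertices ht x hx)
  have h3 := Finset.card_le_card h2
  rw [(S.isPentagonTile t (patch_subset_tiles ht)).card_corners] at h3
  rw [Finset.sum_const, nsmul_eq_mul, mul_one]
  exact_mod_cast h3

lemma sum_valence_le (S : PentagonSystem T) {r : ℝ} (M : Plane) {J : ℝ}
    (hJ : ∀ x, (valence T x : ℝ) ≤ J) :
    ∑ x ∈ S.patchVertices r M, (valence T x : ℝ) ≤ 10 / 3 * (S.patchVertices r M).card +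
      J * ((S.patchVertices r M).filter fun x => r < dist x M).card := by
  classical
  set V := S.patchVertices r M with hV
  let g : Plane → Set Plane → ℝ := fun x t => 1 - 10 / 3 * S.dens t x
  have hg1 : ∀ t ∈ T.tiles, ∀ x, g x t ≤ 1 := fun t ht x => by
    have := (S.isPentagonTile t ht).dens_nonneg x
    simp only [g]
    linarith
  have hinner : ∑ x ∈ V, ∑ t ∈ (S.tilesAt x).filter (· ∈ patch T r M), g x t ≤ 0 := by
    rw [hV, S.sum_patchVertices_comm]
    refine Finset.sum_nonpos fun t ht => ?_
    have ht := (Set.Finite.mem_toFinset _).1 ht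
    have htile := S.isPentagonTile t (patch_subset_tiles ht)
    have hsub : S.corners t ⊆ (S.patchVertices r M).filter (· ∈ t) := fun x hx =>
      Finset.mem_filter.2 (S.corners_subset_patchVertices ht x hx)
    rw [← Finset.sum_sdiff hsub]
    have h1 : ∑ x ∈ S.corners t, g x t ≤ 0 := by
      simp only [g]
      rw [Finset.sum_sub_distrib, ← Finset.mul_sum, Finset.sum_const, htile.card_corners]
      have := htile.dens_sum
      norm_num
      linarith
    have h2 : ∑ x ∈ (S.patchVertices r M).filter (· ∈ t) \ S.corners t, g x t ≤ 0 := by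
      refine Finset.sum_nonpos fun x hx => ?_
      simp only [g]
      rw [htile.dens_eq_half x (Finset.mem_sdiff.1 hx).2]
      norm_num
    linarith
  have hpoint : ∀ x ∈ V, (valence T x : ℝ) ≤ 10 / 3 +
      ∑ t ∈ (S.tilesAt x).filter (· ∈ patch T r M), g x t + if r < dist x M then J else 0 := by
    intro x _
    have h1 : (valence T x : ℝ) ≤ 10 / 3 + ∑ t ∈ S.tilesAt x, g x t := by
      simp only [g]
      rw [Finset.sum_sub_distrib, ← Finset.mul_sum, Finset.sum_const, ← S.valence_eq_card]
      have := S.sum_dens_le_one x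
      norm_num
      linarith
    rw [← Finset.sum_filter_add_sum_filter_not (S.tilesAt x) (· ∈ patch T r M)] at h1
    have h2 : ∑ t ∈ (S.tilesAt x).filter (· ∉ patch T r M), g x t ≤
        if r < dist x M then J else 0 := by
      split_ifs with hr
      · refine (Finset.sum_le_card_nsmul _ _ 1 fun t ht => ?_).trans ?_
        · exact hg1 t (S.mem_tilesAt.1 (Finset.mem_filter.1 ht).1).1 x
        · rw [nsmul_eq_mul, mul_one]
          refine le_trans ?_ (hJ x)
          rw [S.valence_eq_card]
          exact_mod_cast Finset.card_filter_le _ _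
      · refine (Finset.sum_eq_zero fun t ht => ?_).le
        obtain ⟨ht, hnot⟩ := Finset.mem_filter.1 ht
        obtain ⟨htT, hxt⟩ := S.mem_tilesAt.1 ht
        exact absurd (S.mem_patch_of_mem_closedBall htT hxt (mem_closedBall.2 (not_lt.1 hr))) hnot
    linarith
  refine (Finset.sum_le_sum hpoint).trans ?_
  rw [Finset.sum_add_distrib, Finset.sum_add_distrib, Finset.sum_const, ← Finset.sum_filter,
    Finset.sum_const, nsmul_eq_mul, nsmul_eq_mul]
  linarith

lemma vjCount_eq_card (S : PentagonSystem T) {j : ℕ} (hj : 3 ≤ j) (r : ℝ) (M : Plane) :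
    vjCount T j r M = ((S.patchVertices r M).filter fun x => valence T x = j).card := by
  rw [vjCount, ← Set.ncard_coe_finset]
  congr 1
  ext x
  simp only [Set.mem_ofPred_eq, Finset.coe_filter, S.mem_patchVertices, IsTilingVertex]
  constructor
  · rintro ⟨h, hx⟩
    exact ⟨⟨h ▸ hj, hx⟩, h⟩
  · rintro ⟨⟨-, hx⟩, h⟩
    exact ⟨h, hx⟩

lemma sum_patchVertices_eq (S : PentagonSystem T) {J : ℕ} (hJ : ∀ x, valence T x ≤ J)
    (φ : ℕ → ℝ) (r : ℝ) (M : Plane) :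
    ∑ x ∈ S.patchVertices r M, φ (valence T x) =
      ∑ j ∈ Finset.Icc 3 J, φ j * (vjCount T j r M : ℝ) := by
  rw [← Finset.sum_fiberwise_of_maps_to (g := valence T) (t := Finset.Icc 3 J)
    fun x hx => Finset.mem_Icc.2 ⟨(S.mem_patchVertices.1 hx).1, hJ x⟩]
  refine Finset.sum_congr rfl fun j hj => ?_
  rw [S.vjCount_eq_card (Finset.mem_Icc.1 hj).1, mul_comm, ← nsmul_eq_mul, ← Finset.sum_const]
  exact Finset.sum_congr rfl fun x hx => by rw [(Finset.mem_filter.1 hx).2]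

lemma tCount_pos (S : PentagonSystem T) {r : ℝ} (hr : 0 < r) (M : Plane) :
    0 < (tCount T r M : ℝ) := by
  have h := S.sq_le_tCount_mul hr.le M
  have h1 : 0 < (tCount T r M : ℝ) * S.U ^ 2 := (pow_pos hr 2).trans_le h
  exact pos_of_mul_pos_left h1 (sq_nonneg _)

lemma tendsto_boundary_vertices_div (S : PentagonSystem T) (M : Plane) :
    Tendsto (fun r : ℝ => (((S.patchVertices r M).filter fun x => r < dist x M).card : ℝ) /
      (tCount T r M : ℝ)) atTop (nhds 0) := by
  have hU := S.U_pos
  have hu := S.u_pos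
  have hlim : Tendsto (fun r : ℝ => 45 * S.U ^ 3 / S.u ^ 2 / r) atTop (nhds 0) :=
    tendsto_const_nhds.div_atTop tendsto_id
  refine squeeze_zero' (Eventually.of_forall fun r => by positivity) ?_ hlim
  filter_upwards [eventually_ge_atTop S.U] with r hr
  have hr0 : 0 < r := hU.trans_le hr
  have h1 := S.card_boundary_vertices_mul_le hr M
  have h2 := S.sq_le_tCount_mul hr0.le M
  have ht := S.tCount_pos hr0 M
  set E : ℝ := (((S.patchVertices r M).filter fun x => r < dist x M).card : ℝ)
  set t : ℝ := (tCount T r M : ℝ)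
  rw [div_div, div_le_div_iff₀ ht (by positivity)]
  have h3 : E * S.u ^ 2 ≤ 45 * S.U * r := by nlinarith
  calc E * (S.u ^ 2 * r) = E * S.u ^ 2 * r := by ring
    _ ≤ 45 * S.U * r * r := by gcongr
    _ = 45 * S.U * r ^ 2 := by ring
    _ ≤ 45 * S.U * (t * S.U ^ 2) := by gcongr
    _ = 45 * S.U ^ 3 * t := by ring

end PentagonSystem

lemma tsum_three_le_eq_sum_Icc {f : ℕ → ℝ} {J : ℕ} (hf : ∀ j, 3 ≤ j → J < j → f j = 0) :
    ∑' j : {n : ℕ // 3 ≤ n}, f j = ∑ j ∈ Finset.Icc 3 J, f j := by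
  rw [tsum_eq_sum (s := (Finset.Icc 3 J).subtype (3 ≤ ·)), Finset.sum_subtype_eq_sum_filter,
    Finset.filter_true_of_mem fun j hj => (Finset.mem_Icc.1 hj).1]
  intro j hj
  apply hf j j.2
  by_contra hle
  exact hj (Finset.mem_subtype.2 (Finset.mem_Icc.2 ⟨j.2, not_lt.1 hle⟩))

/-- For every strongly balanced tiling of the plane by isometric
copies of a single convex pentagon, the average valence of the vertices satisfies
`3 ≤ Σ_{j≥3} j·w_j(𝔗) ≤ 10/3`. -/
theorem stronglyBalanced_pentagon_average_valence_bounds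
    (p : Fin 5 → Plane) (hp : IsConvexPentagon p) (T : PlaneTiling)
    (hmono : IsMonohedralBy T (convexHull ℝ (Set.range p)))
    (hnorm : IsNormal T) (tl vl : ℕ → ℝ)
    (htl : ∀ M : Plane, ∀ h : ℕ, 3 ≤ h →
      Tendsto (fun r : ℝ => (thCount T h r M : ℝ) / (tCount T r M : ℝ)) atTop (nhds (tl h)))
    (hvl : ∀ M : Plane, ∀ j : ℕ, 3 ≤ j →
      Tendsto (fun r : ℝ => (vjCount T j r M : ℝ) / (tCount T r M : ℝ)) atTop (nhds (vl j))) :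
    3 ≤ (∑' j : {n : ℕ // 3 ≤ n}, ((j : ℕ) : ℝ) *
          (vl (j : ℕ) / ∑' k : {n : ℕ // 3 ≤ n}, vl (k : ℕ))) ∧
    (∑' j : {n : ℕ // 3 ≤ n}, ((j : ℕ) : ℝ) *
          (vl (j : ℕ) / ∑' k : {n : ℕ // 3 ≤ n}, vl (k : ℕ))) ≤ 10 / 3 := by
  obtain ⟨S⟩ := nonempty_pentagonSystem hp.1 hmono hnorm
  obtain ⟨J, hJ⟩ : ∃ J : ℕ, ∀ x, valence T x ≤ J := by
    refine ⟨⌈S.U ^ 2 / S.u ^ 2⌉₊, fun x => ?_⟩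
    have h := (le_div_iff₀ (pow_pos S.u_pos 2)).2 (S.valence_mul_le x)
    exact_mod_cast h.trans (Nat.le_ceil _)
  have hnonneg : ∀ j, 3 ≤ j → 0 ≤ vl j := fun j hj =>
    ge_of_tendsto' (hvl 0 j hj) fun r => by positivity
  have hzero : ∀ j, 3 ≤ j → J < j → vl j = 0 := by
    intro j hj hJj
    refine tendsto_nhds_unique (hvl 0 j hj) (Tendsto.congr (fun r => ?_) tendsto_const_nhds)
    have h : vjCount T j r 0 = 0 := by
      rw [S.vjCount_eq_card hj, Finset.card_eq_zero, Finset.filter_eq_empty_iff]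
      intro x _ hx
      have := hJ x
      omega
    simp [h]
  have hlim : ∀ φ : ℕ → ℝ, Tendsto (fun r : ℝ =>
      (∑ x ∈ S.patchVertices r 0, φ (valence T x)) / (tCount T r 0 : ℝ)) atTop
      (nhds (∑ j ∈ Finset.Icc 3 J, φ j * vl j)) := by
    intro φ
    simp_rw [S.sum_patchVertices_eq hJ, Finset.sum_div, mul_div_assoc]
    exact tendsto_finsetSum _ fun j hj => (hvl 0 j (Finset.mem_Icc.1 hj).1).const_mul _
  have hlim1 := hlim fun j => j
  have hlim0 := hlim fun _ => 1
  simp only [one_mul, Finset.sum_const, nsmul_eq_mul, mul_one] at hlim0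
  have htsum : ∑' k : {n : ℕ // 3 ≤ n}, vl (k : ℕ) = ∑ j ∈ Finset.Icc 3 J, vl j :=
    tsum_three_le_eq_sum_Icc hzero
  have htsum' : ∀ v : ℝ, ∑' j : {n : ℕ // 3 ≤ n}, ((j : ℕ) : ℝ) * (vl (j : ℕ) / v) =
      (∑ j ∈ Finset.Icc 3 J, (j : ℝ) * vl j) / v := by
    intro v
    rw [tsum_three_le_eq_sum_Icc (f := fun j => (j : ℝ) * (vl j / v)) (J := J)
      fun j h3 hj => by simp [hzero j h3 hj], Finset.sum_div]
    simp_rw [mul_div_assoc]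
  rw [htsum, htsum']
  set v₀ := ∑ j ∈ Finset.Icc 3 J, vl j
  set v₁ := ∑ j ∈ Finset.Icc 3 J, (j : ℝ) * vl j
  have h5 : 5 ≤ v₁ := by
    refine ge_of_tendsto hlim1 ?_
    filter_upwards [eventually_gt_atTop 0] with r hr
    rw [le_div_iff₀ (S.tCount_pos hr 0)]
    exact S.five_mul_tCount_le r 0
  have hupper : v₁ ≤ 10 / 3 * v₀ := by
    have hright := (hlim0.const_mul (10 / 3)).add
      ((S.tendsto_boundary_vertices_div 0).const_mul (J : ℝ))
    rw [mul_zero, add_zero] at hright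
    refine le_of_tendsto_of_tendsto' hlim1 hright fun r => ?_
    rw [← mul_div_assoc, ← mul_div_assoc, ← add_div]
    gcongr
    exact S.sum_valence_le 0 fun x => by exact_mod_cast hJ x
  have hlower : 3 * v₀ ≤ v₁ := by
    rw [Finset.mul_sum]
    refine Finset.sum_le_sum fun j hj => ?_
    have h3 := (Finset.mem_Icc.1 hj).1
    exact mul_le_mul_of_nonneg_right (by exact_mod_cast h3) (hnonneg j h3)
  have hpos : 0 < v₀ := by linarith
  exact ⟨(le_div_iff₀ hpos).2 hlower, (div_le_iff₀ hpos).2 hupper⟩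
end
end
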